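/- arXiv:2102.00739 — 11 statements merged into one kernel-verified Lean document; each statement's English description precedes it below -/
import Mathlib

section
/- Let N be an even positive integer and let k1, k2 be integers with 0 ≤ k2 ≤ k1 ≤ N. Then for every nonnegative integer threshold n̄, the probability that a uniformly random grouping of the set [k1,N] produces strictly fewer than n̄ ww-pairs is at most the probability that a uniformly random grouping of the set [k2,N] produces strictly fewer than n̄ ww-pairs; that is, ε(n̄ | [k1,N]) ≤ ε(n̄ | [k2,N]). (Paper's Lemma 1.) -/
/-- Number of ww-pairs: positions are grouped into the pairs `{2i, 2i+1}`; the ball at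
position `j` is white iff `σ j < k`. A uniformly random permutation `σ` of the `N`
positions realizes a uniformly random grouping (perfect matching) of a set of
`k` white and `N - k` black balls. -/
def wwCount (N k : ℕ) (σ : Equiv.Perm (Fin N)) : ℕ :=
  (Finset.univ.filter fun i : Fin (N / 2) =>
    (σ ⟨2 * i.1, by have := i.isLt; omega⟩).1 < k ∧
    (σ ⟨2 * i.1 + 1, by have := i.isLt; omega⟩).1 < k).card

/-- ε(n̄ | [k,N]): the probability that a uniformly random grouping of `[k,N]`
produces strictly fewer than `n̄` ww-pairs. -/
noncomputable def epsWW (N k nbar : ℕ) : ℝ :=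
  (Finset.univ.filter fun σ : Equiv.Perm (Fin N) => wwCount N k σ < nbar).card /
    (Fintype.card (Equiv.Perm (Fin N)))

/-- Paper's Lemma 1: if `k2 ≤ k1 ≤ N`, then for every threshold `n̄`,
ε(n̄ | [k1,N]) ≤ ε(n̄ | [k2,N]). -/
theorem lemma1_ww_monotone (N k1 k2 nbar : ℕ) (hN : Even N) (hNpos : 0 < N)
    (hk21 : k2 ≤ k1) (hk1N : k1 ≤ N) :
    epsWW N k1 nbar ≤ epsWW N k2 nbar := by
  have hww : ∀ σ : Equiv.Perm (Fin N), wwCount N k2 σ ≤ wwCount N k1 σ := by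
    intro σ
    unfold wwCount
    apply Finset.card_le_card
    intro i hi
    rw [Finset.mem_filter] at hi ⊢
    exact ⟨hi.1, lt_of_lt_of_le hi.2.1 hk21, lt_of_lt_of_le hi.2.2 hk21⟩
  unfold epsWW
  refine div_le_div_of_nonneg_right ?_ (Nat.cast_nonneg _)
  refine Nat.cast_le.mpr (Finset.card_le_card ?_)
  intro σ h
  rw [Finset.mem_filter] at h ⊢
  exact ⟨h.1, lt_of_le_of_lt (hww σ) h.2⟩
end

section
/- Let N be an even positive integer, k_u a nonnegative integer with k_u ≤ N, n̄ a nonnegative integer, and p_u ∈ [0,1]. Set γ_iid = Σ_{k=0}^{k_u} C(N,k) p_u^k (1−p_u)^{N−k}, and assume γ_iid > 0. Then ε(n̄ | [k_u,N]) ≤ ε(n̄ | [p_u,N]_iid) / γ_iid. (Paper's Theorem 1.) -/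
/-- ε(n̄ | [p,N]_iid): the binomial mixture Σ_m C(N,m) p^m (1-p)^(N-m) ε(n̄ | [m,N]). -/
noncomputable def epsWWiid (N nbar : ℕ) (p : ℝ) : ℝ :=
  ∑ m ∈ Finset.range (N + 1),
    (N.choose m : ℝ) * p ^ m * (1 - p) ^ (N - m) * epsWW N m nbar

theorem wwCount_mono_aux (N : ℕ) {k l : ℕ} (h : k ≤ l) (σ : Equiv.Perm (Fin N)) :
    wwCount N k σ ≤ wwCount N l σ := by
  unfold wwCount
  apply Finset.card_le_card
  intro i hi
  rw [Finset.mem_filter] at hi ⊢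
  exact ⟨hi.1, lt_of_lt_of_le hi.2.1 h, lt_of_lt_of_le hi.2.2 h⟩

theorem epsWW_anti_aux (N nbar : ℕ) {k l : ℕ} (h : k ≤ l) :
    epsWW N l nbar ≤ epsWW N k nbar := by
  unfold epsWW
  refine div_le_div_of_nonneg_right ?_ (Nat.cast_nonneg _)
  refine Nat.cast_le.mpr (Finset.card_le_card ?_)
  intro σ hσ
  rw [Finset.mem_filter] at hσ ⊢
  exact ⟨hσ.1, lt_of_le_of_lt (wwCount_mono_aux N h σ) hσ.2⟩

theorem epsWW_nonneg_aux (N k nbar : ℕ) : 0 ≤ epsWW N k nbar := by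
  unfold epsWW
  positivity

/-- Paper's Theorem 1: ε(n̄ | [k_u,N]) ≤ ε(n̄ | [p_u,N]_iid) / γ_iid, where
γ_iid = Σ_{k=0}^{k_u} C(N,k) p_u^k (1-p_u)^(N-k) is assumed positive. -/
theorem theorem1_ww_iid_bound (N ku nbar : ℕ) (hN : Even N) (hNpos : 0 < N)
    (hku : ku ≤ N) (pu : ℝ) (hp0 : 0 ≤ pu) (hp1 : pu ≤ 1) (γiid : ℝ)
    (hγ : γiid = ∑ k ∈ Finset.range (ku + 1),
      (N.choose k : ℝ) * pu ^ k * (1 - pu) ^ (N - k))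
    (hγpos : 0 < γiid) :
    epsWW N ku nbar ≤ epsWWiid N nbar pu / γiid := by
  have hq : 0 ≤ 1 - pu := by linarith
  have hw : ∀ m : ℕ, 0 ≤ (N.choose m : ℝ) * pu ^ m * (1 - pu) ^ (N - m) := by
    intro m
    positivity
  rw [le_div_iff₀ hγpos, hγ, Finset.mul_sum]
  unfold epsWWiid
  calc _ ≤ ∑ m ∈ Finset.range (ku + 1),
        (N.choose m : ℝ) * pu ^ m * (1 - pu) ^ (N - m) * epsWW N m nbar := by
        refine Finset.sum_le_sum fun m hm => ?_
        rw [mul_comm]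
        refine mul_le_mul_of_nonneg_left (epsWW_anti_aux N nbar ?_) (hw m)
        have := Finset.mem_range.mp hm
        omega
    _ ≤ _ := by
        refine Finset.sum_le_sum_of_subset_of_nonneg ?_ ?_
        · exact Finset.range_mono (by omega)
        · intro m _ _
          exact mul_nonneg (hw m) (epsWW_nonneg_aux N m nbar)
end

section
/- Let N be an even positive integer, k an integer with 0 ≤ k ≤ N, and n̄ a nonnegative integer. Write p_u = k/N. Then the probability that a uniformly random grouping of [k,N] produces strictly fewer than n̄ ww-pairs satisfies the explicit bound ε(n̄ | [k,N]) ≤ 2 Σ_{l=0}^{n̄−1} C(N/2, l) p_u^{2l} (1 − p_u^2)^{N/2 − l}, i.e. ε(n̄ | [k,N]) ≤ 2 ξ_L(n̄; p_u^2, N/2). (Paper's Result 2.1, explicit binomial form, Eqs. (4)–(6).) -/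
open Finset Polynomial in
lemma gen_coeff (A B : ℝ) (M l : ℕ) :
    ((C A * X + C B : ℝ[X]) ^ M).coeff l = (M.choose l : ℝ) * A ^ l * B ^ (M - l) := by
  rw [add_pow, finsetSum_coeff]
  have : ∀ m ∈ range (M+1), ((C A * X : ℝ[X]) ^ m * (C B) ^ (M - m) * (M.choose m : ℝ[X])).coeff l
      = if m = l then (M.choose l : ℝ) * A ^ l * B ^ (M - l) else 0 := by
    intro m _
    have e : ((C A * X : ℝ[X]) ^ m * (C B) ^ (M - m) * (M.choose m : ℝ[X]))
        = C ((M.choose m : ℝ) * A ^ m * B ^ (M - m)) * X ^ m := by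
      simp only [map_mul, map_pow, map_natCast]; ring
    rw [e, coeff_C_mul_X_pow]
    by_cases h : l = m
    · subst h; simp
    · rw [if_neg h, if_neg (Ne.symm h)]
  rw [sum_congr rfl this, sum_ite_eq']
  split_ifs with h
  · rfl
  · have : M < l := by simpa using h
    simp [Nat.choose_eq_zero_of_lt this]

open Finset Polynomial in
lemma gen_count {α : Type} [Fintype α] (wt : α → ℝ) (P : α → Prop) [DecidablePred P] (M n : ℕ) :
    ∑ c : Fin M → α, (if (univ.filter fun i => P (c i)).card < n then ∏ i, wt (c i) else 0)
    = ∑ l ∈ range n, (M.choose l : ℝ) * (∑ a, if P a then wt a else 0) ^ l *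
        (∑ a, if P a then 0 else wt a) ^ (M - l) := by
  set A := (∑ a, if P a then wt a else 0) with hA
  set B := (∑ a, if P a then 0 else wt a) with hB
  have h1 : (C A * X + C B : ℝ[X]) = ∑ a, C (wt a) * X ^ (if P a then 1 else 0) := by
    rw [hA, hB, map_sum, map_sum, sum_mul, ← sum_add_distrib]
    apply sum_congr rfl
    intro a _
    split_ifs <;> simp
  have h2 : (C A * X + C B : ℝ[X]) ^ M
      = ∑ c : Fin M → α, C (∏ i, wt (c i)) * X ^ (univ.filter fun i => P (c i)).card := by
    rw [h1, Fintype.sum_pow]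
    apply sum_congr rfl
    intro c _
    rw [prod_mul_distrib, prod_pow_eq_pow_sum, map_prod, card_filter]
  have h3 : ∀ l ∈ range n, (M.choose l : ℝ) * A ^ l * B ^ (M - l)
      = ∑ c : Fin M → α, if (univ.filter fun i => P (c i)).card = l then ∏ i, wt (c i) else 0 := by
    intro l _
    rw [← gen_coeff, h2, finsetSum_coeff]
    apply sum_congr rfl
    intro c _
    rw [coeff_C_mul_X_pow]
    simp only [eq_comm]
  rw [sum_congr rfl h3, sum_comm]
  apply sum_congr rfl
  intro c _
  rw [sum_ite_eq]
  simp

lemma prod_pair (N M : ℕ) (h : N = M * 2) (g : Fin N → ℝ) :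
    ∏ j, g j = ∏ i : Fin M, (g ⟨2 * i.1, by have := i.isLt; omega⟩ *
      g ⟨2 * i.1 + 1, by have := i.isLt; omega⟩) := by
  subst h
  rw [← finProdFinEquiv.prod_comp, Fintype.prod_prod_type]
  apply Finset.prod_congr rfl
  intro i _
  rw [Fin.prod_univ_two]
  congr 2 <;> ext <;> simp [finProdFinEquiv] <;> ring

def pairUp (N M : ℕ) (h : N = M * 2) : (Fin N → Bool) ≃ (Fin M → Bool × Bool) where
  toFun c i := (c ⟨2 * i.1, by have := i.isLt; omega⟩, c ⟨2 * i.1 + 1, by have := i.isLt; omega⟩)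
  invFun d j := if j.1 % 2 = 0 then (d ⟨j.1 / 2, by have := j.isLt; omega⟩).1
    else (d ⟨j.1 / 2, by have := j.isLt; omega⟩).2
  left_inv c := by
    ext j
    dsimp only
    split_ifs with hj
    · congr 1; apply Fin.ext; simp; omega
    · congr 1; apply Fin.ext; simp; omega
  right_inv d := by
    ext i
    · simp
    · dsimp only
      rw [if_neg (by omega)]
      congr 2; apply Fin.ext; simp; omega

/-- median -/
lemma median_aux (k m : ℕ) (hk : 0 < k) (hm : 0 < m) :
    (1:ℝ) * (k + m : ℝ) ^ (k + m) ≤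
      2 * ∑ i ∈ Finset.range (k + 1), ((k + m).choose i : ℝ) * (k:ℝ) ^ i * (m:ℝ) ^ (k + m - i) := by
  classical
  set n := k + m with hn
  set a : ℕ → ℝ := fun i => (n.choose i : ℝ) * (k:ℝ) ^ i * (m:ℝ) ^ (n - i) with ha
  have hkr : (0:ℝ) < k := by exact_mod_cast hk
  have hmr : (0:ℝ) < m := by exact_mod_cast hm
  have hnr : (n:ℝ) = k + m := by rw [hn]; push_cast; ring
  have a0 : ∀ i, 0 ≤ a i := fun i => by positivity
  have abig : ∀ i, n < i → a i = 0 := fun i hi => by simp [ha, Nat.choose_eq_zero_of_lt hi]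
  have rec1 : ∀ i : ℕ, ((i:ℝ) + 1) * m * a (i+1) = ((n:ℝ) - i) * k * a i := by
    intro i
    rcases lt_trichotomy i n with h | h | h
    · have e : n - i = (n - (i+1)) + 1 := by omega
      have c := Nat.choose_succ_right_eq n i
      have c' : (n.choose (i+1) : ℝ) * (i+1) = n.choose i * ((n:ℝ) - i) := by
        rw [← Nat.cast_sub h.le]; exact_mod_cast c
      simp only [ha]
      rw [e, pow_succ, pow_succ]
      linear_combination (k:ℝ)^i * k * m ^ (n - (i+1)) * m * c'
    · rw [abig (i+1) (by omega), h]; simp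
    · rw [abig (i+1) (by omega), abig i h]; simp
  have S0 : ∑ i ∈ Finset.range (n+1), a i = (k + m : ℝ) ^ n := by
    rw [add_pow]; apply Finset.sum_congr rfl; intro i _; simp only [ha]; ring
  have S1 : ∑ i ∈ Finset.range (n+1), (i:ℝ) * a i = k * (k + m : ℝ) ^ n := by
    have e1 : ∑ i ∈ Finset.range (n+1), ((i:ℝ) + 1) * m * a (i+1)
        = m * ∑ i ∈ Finset.range (n+1), (i:ℝ) * a i := by
      have := Finset.sum_range_succ' (fun i : ℕ => (m:ℝ) * ((i:ℝ) * a i)) (n+1)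
      rw [Finset.sum_range_succ, abig (n+1) (by omega)] at this
      rw [Finset.mul_sum]
      simp at this
      rw [this]
      apply Finset.sum_congr rfl; intro i _; ring
    have e2 : ∑ i ∈ Finset.range (n+1), ((n:ℝ) - i) * k * a i
        = k * n * (k + m : ℝ) ^ n - k * ∑ i ∈ Finset.range (n+1), (i:ℝ) * a i := by
      rw [← S0, Finset.mul_sum, Finset.mul_sum, ← Finset.sum_sub_distrib]
      apply Finset.sum_congr rfl; intro i _; ring
    rw [Finset.sum_congr rfl (fun i _ => rec1 i), e2] at e1
    have hp : (0:ℝ) < k + m := by positivity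
    apply mul_left_cancel₀ hp.ne'
    rw [hnr] at e1
    linarith
  -- the two tails
  set x : ℕ → ℝ := fun j => if j ≤ k then a (k - j) else 0 with hx
  set y : ℕ → ℝ := fun j => a (k + 1 + j) with hy
  have x0 : ∀ j, 0 ≤ x j := fun j => by simp only [hx]; split_ifs; exact a0 _; exact le_rfl
  have y0 : ∀ j, 0 ≤ y j := fun j => a0 _
  have split : ∀ f : ℕ → ℝ, ∑ i ∈ Finset.range (n+1), f i * a i =
      ∑ j ∈ Finset.range (n+1), (f (k - j) * x j + f (k+1+j) * y j) := by
    intro f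
    rw [Finset.sum_add_distrib]
    have e1 : ∑ j ∈ Finset.range (n+1), f (k - j) * x j = ∑ i ∈ Finset.range (k+1), f i * a i := by
      rw [← Finset.sum_range_reflect (fun i => f i * a i) (k+1), ← Finset.sum_subset (Finset.range_mono (by omega : k + 1 ≤ n + 1))]
      · apply Finset.sum_congr rfl
        intro j hj
        have : j ≤ k := by simpa [Nat.lt_succ_iff] using hj
        simp [hx, this]
      · intro j _ hj
        have : ¬ j ≤ k := by simpa [Nat.lt_succ_iff] using hj
        simp [hx, this]
    have e2 : ∑ j ∈ Finset.range (n+1), f (k+1+j) * y j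
        = ∑ j ∈ Finset.range m, f (k+1+j) * a (k+1+j) := by
      rw [← Finset.sum_subset (Finset.range_mono (by omega : m ≤ n + 1))]
      intro j _ hj
      have : m ≤ j := by simpa using hj
      simp only [hy]
      rw [abig _ (by omega)]; simp
    rw [e1, e2, ← Finset.sum_range_add (fun i => f i * a i) (k+1) m]
    congr 2; omega
  have recx : ∀ j, j < k → ((m:ℝ) + (j + 1)) * k * x (j+1) = ((k:ℝ) - j) * m * x j := by
    intro j hj
    have h1 := rec1 (k - (j+1))
    have e : k - (j+1) + 1 = k - j := by omega
    rw [e, Nat.cast_sub (by omega), hnr] at h1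
    simp only [hx, if_pos hj.le, if_pos (show j + 1 ≤ k by omega)]
    push_cast at h1
    linarith
  have recy : ∀ j, ((k:ℝ) + j + 2) * m * y (j+1) = ((m:ℝ) - (j+1)) * k * y j := by
    intro j
    have h1 := rec1 (k + 1 + j)
    rw [hnr] at h1
    simp only [hy]
    rw [← add_assoc]
    push_cast at h1
    linarith
  have up : ∀ j, j < k → x j ≤ y j → (2*(k:ℝ)+1)*m^2 ≤ ((j:ℝ)+1)^2*((m:ℝ)^2-k^2) →
      x (j+1) ≤ y (j+1) := by
    intro j hj hxy hT
    have hjr : (j:ℝ) < k := by exact_mod_cast hj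
    have h1 := recx j hj
    have h2 := recy j
    have hc : (0:ℝ) < (k + j + 2) * m * ((m + (j+1)) * k) := by positivity
    refine le_of_mul_le_mul_left ?_ hc
    have e1 : ((k:ℝ) + j + 2) * m * ((m + (j+1)) * k) * x (j+1)
        = (k - j) * (k + j + 2) * m^2 * x j := by linear_combination ((k:ℝ) + j + 2) * m * h1
    have e2 : ((k:ℝ) + j + 2) * m * ((m + (j+1)) * k) * y (j+1)
        = (m^2 - (j+1)^2) * k^2 * y j := by linear_combination ((m:ℝ) + (j+1)) * k * h2
    rw [e1, e2]
    have hd : 0 ≤ ((k:ℝ) - j) * (k + j + 2) * m^2 := by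
      have : 0 < (k:ℝ) - j := by linarith
      positivity
    calc _ ≤ ((k:ℝ) - j) * (k + j + 2) * m^2 * y j := mul_le_mul_of_nonneg_left hxy hd
      _ ≤ _ := mul_le_mul_of_nonneg_right (by nlinarith) (y0 j)
  have dn : ∀ j, j < k → y j ≤ x j → ((j:ℝ)+1)^2*((m:ℝ)^2-k^2) ≤ (2*(k:ℝ)+1)*m^2 →
      y (j+1) ≤ x (j+1) := by
    intro j hj hxy hT
    have hjr : (j:ℝ) < k := by exact_mod_cast hj
    have h1 := recx j hj
    have h2 := recy j
    have hc : (0:ℝ) < (k + j + 2) * m * ((m + (j+1)) * k) := by positivity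
    refine le_of_mul_le_mul_left ?_ hc
    have e1 : ((k:ℝ) + j + 2) * m * ((m + (j+1)) * k) * x (j+1)
        = (k - j) * (k + j + 2) * m^2 * x j := by linear_combination ((k:ℝ) + j + 2) * m * h1
    have e2 : ((k:ℝ) + j + 2) * m * ((m + (j+1)) * k) * y (j+1)
        = (m^2 - (j+1)^2) * k^2 * y j := by linear_combination ((m:ℝ) + (j+1)) * k * h2
    rw [e1, e2]
    have hd : 0 ≤ ((k:ℝ) - j) * (k + j + 2) * m^2 := by
      have : 0 < (k:ℝ) - j := by linarith
      positivity
    calc _ ≤ ((k:ℝ) - j) * (k + j + 2) * m^2 * y j :=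
          mul_le_mul_of_nonneg_right (by nlinarith) (y0 j)
      _ ≤ _ := mul_le_mul_of_nonneg_left hxy hd
  have start : y 0 ≤ x 0 := by
    have h := rec1 k
    rw [hnr] at h
    simp only [hx, hy]
    simp only [zero_le, if_true, Nat.sub_zero, add_zero]
    have h' : ((k:ℝ) + 1) * a (k+1) = k * a k := by
      apply mul_left_cancel₀ hmr.ne'; linarith
    nlinarith [a0 k, a0 (k+1)]
  have D1 : ∑ j ∈ Finset.range (n+1), (2*(j:ℝ)+1) * (x j - y j) = (k + m : ℝ) ^ n := by
    have h := split (fun i => 2*(k:ℝ) + 1 - 2 * i)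
    have h' : ∑ i ∈ Finset.range (n+1), (2*(k:ℝ) + 1 - 2 * i) * a i = (k + m : ℝ) ^ n := by
      have : ∀ i ∈ Finset.range (n+1), (2*(k:ℝ) + 1 - 2 * i) * a i
          = (2*(k:ℝ) + 1) * a i - 2 * (i * a i) := by intro i _; ring
      rw [Finset.sum_congr rfl this, Finset.sum_sub_distrib, ← Finset.mul_sum, ← Finset.mul_sum,
        S0, S1]; ring
    rw [← h', h]
    apply Finset.sum_congr rfl
    intro j _
    by_cases hj : j ≤ k
    · rw [Nat.cast_sub hj]; push_cast; ring
    · simp only [hx, if_neg hj]; push_cast; ring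
  have D0 : ∑ j ∈ Finset.range (n+1), (x j - y j) =
      2 * ∑ i ∈ Finset.range (k + 1), a i - (k + m : ℝ) ^ n := by
    have h := split (fun i => if i ≤ k then 1 else -1)
    have h2 := split (fun i => if i ≤ k then 1 else 0)
    have e : ∑ i ∈ Finset.range (n+1), (if i ≤ k then (1:ℝ) else 0) * a i
        = ∑ i ∈ Finset.range (k + 1), a i := by
      rw [← Finset.sum_subset (Finset.range_mono (by omega : k + 1 ≤ n + 1))]
      · apply Finset.sum_congr rfl
        intro j hj
        have : j ≤ k := by simpa [Nat.lt_succ_iff] using hj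
        simp [this]
      · intro j _ hj
        have : ¬ j ≤ k := by simpa [Nat.lt_succ_iff] using hj
        simp [this]
    have e2 : ∑ j ∈ Finset.range (n+1), (x j - y j) =
        ∑ i ∈ Finset.range (n+1), (if i ≤ k then (1:ℝ) else -1) * a i := by
      rw [h]
      apply Finset.sum_congr rfl
      intro j _
      rw [if_pos (by omega), if_neg (by omega)]; ring
    rw [e2, ← e, ← S0, Finset.mul_sum, ← Finset.sum_sub_distrib]
    apply Finset.sum_congr rfl
    intro j _
    split_ifs <;> ring
  suffices h : 0 ≤ ∑ j ∈ Finset.range (n+1), (x j - y j) by rw [D0] at h; linarith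
  by_cases hall : ∀ j, y j ≤ x j
  · exact Finset.sum_nonneg (fun j _ => sub_nonneg.2 (hall j))
  push Not at hall
  obtain ⟨J, hJ, hmin⟩ : ∃ J, x J < y J ∧ ∀ j < J, y j ≤ x j :=
    ⟨Nat.find hall, Nat.find_spec hall, fun j hj => not_lt.1 (Nat.find_min hall hj)⟩
  have hJ0 : 0 < J := by
    rcases Nat.eq_zero_or_pos J with h | h
    · subst h; linarith
    · exact h
  have hafter : ∀ d, x (J + d) ≤ y (J + d) := by
    intro d
    by_cases hJk : J ≤ k
    · have hT : (2*(k:ℝ)+1)*m^2 ≤ (J:ℝ)^2*((m:ℝ)^2-k^2) := by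
        by_contra hc
        push Not at hc
        obtain ⟨j, rfl⟩ : ∃ j, J = j + 1 := ⟨J - 1, by omega⟩
        have := dn j (by omega) (hmin j (by omega)) (by push_cast at hc; exact hc.le)
        linarith
      have hpos : 0 ≤ (m:ℝ)^2 - k^2 := by
        by_contra hc
        push Not at hc
        have h1 : (0:ℝ) < (2*k+1)*m^2 := by positivity
        nlinarith [sq_nonneg (J:ℝ)]
      induction d with
      | zero => exact hJ.le
      | succ d ih =>
        by_cases hd : J + d < k
        · refine up (J + d) hd ih (hT.trans ?_)
          apply mul_le_mul_of_nonneg_right _ hpos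
          push_cast
          apply pow_le_pow_left₀ (by positivity)
          have : (0:ℝ) ≤ d := by positivity
          linarith
        · have : x (J + (d+1)) = 0 := by simp only [hx]; rw [if_neg (by omega)]
          rw [this]; exact y0 _
    · have : x (J + d) = 0 := by simp only [hx]; rw [if_neg (by omega)]
      rw [this]; exact y0 _
  have key : 0 ≤ ∑ j ∈ Finset.range (n+1), (2*(J:ℝ) - (2*(j:ℝ)+1)) * (x j - y j) := by
    apply Finset.sum_nonneg
    intro j _
    rcases lt_or_ge j J with h | h
    · have h' : (j:ℝ) + 1 ≤ J := by exact_mod_cast h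
      exact mul_nonneg (by linarith) (sub_nonneg.2 (hmin j h))
    · obtain ⟨d, rfl⟩ := Nat.exists_eq_add_of_le h
      apply mul_nonneg_of_nonpos_of_nonpos
      · push_cast; have : (0:ℝ) ≤ d := by positivity
        linarith
      · exact sub_nonpos.2 (hafter d)
  simp only [sub_mul (2 * (J:ℝ))] at key
  rw [Finset.sum_sub_distrib, ← Finset.mul_sum, D1] at key
  have hJr : (0:ℝ) < J := by exact_mod_cast hJ0
  have hp : (0:ℝ) < (k + m : ℝ) ^ n := by positivity
  by_contra hneg
  push Not at hneg
  nlinarith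

lemma median_bound (N k : ℕ) (hNpos : 0 < N) (hk : k ≤ N) :
    (1:ℝ) ≤ 2 * ∑ i ∈ Finset.range (k + 1), (N.choose i : ℝ) * ((k:ℝ)/N) ^ i *
      (1 - (k:ℝ)/N) ^ (N - i) := by
  have hNr : (0:ℝ) < N := by exact_mod_cast hNpos
  rcases Nat.eq_zero_or_pos k with h0 | h0
  · subst h0; norm_num
  obtain ⟨m, rfl⟩ := Nat.exists_eq_add_of_le hk
  rcases Nat.eq_zero_or_pos m with h1 | h1
  · subst h1
    have hkr : (k:ℝ) ≠ 0 := by positivity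
    rw [Finset.sum_range_succ, Finset.sum_eq_zero]
    · simp [hkr]
    · intro i hi
      have : i < k := by simpa using hi
      simp [hkr]; right; omega
  have h := median_aux k m h0 h1
  have hq : 1 - (k:ℝ)/((k + m : ℕ):ℝ) = m / ((k+m : ℕ):ℝ) := by
    rw [eq_div_iff hNr.ne', sub_mul, div_mul_cancel₀ _ hNr.ne']; push_cast; ring
  rw [hq]
  have e : ∀ i ∈ Finset.range (k+1), ((k+m).choose i : ℝ) * ((k:ℝ)/((k+m:ℕ):ℝ)) ^ i *
      ((m:ℝ)/((k+m:ℕ):ℝ)) ^ (k + m - i) =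
      (((k+m).choose i : ℝ) * (k:ℝ) ^ i * (m:ℝ) ^ (k + m - i)) / ((k+m:ℕ):ℝ)^(k+m) := by
    intro i hi
    have : i ≤ k := by simpa [Nat.lt_succ_iff] using hi
    have e : ((k+m:ℕ):ℝ)^(k+m) = ((k+m:ℕ):ℝ)^i * ((k+m:ℕ):ℝ)^(k+m-i) := by
      rw [← pow_add]; congr 1; omega
    rw [div_pow, div_pow, e]
    field_simp
  rw [Finset.sum_congr rfl e, ← Finset.sum_div, ← mul_div_assoc, le_div_iff₀ (by positivity)]
  push_cast
  exact h

lemma exists_perm_le (N k : ℕ) (hk : k ≤ N) (c : Fin N → Bool)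
    (hc : (Finset.univ.filter fun j => c j = true).card ≤ k) :
    ∃ τ : Equiv.Perm (Fin N), ∀ j, c j = true → (τ j).1 < k := by
  classical
  obtain ⟨T, hT, hTc⟩ := Finset.exists_superset_card_eq hc (by simpa using hk)
  have hcard : Fintype.card {j // j ∈ T} = Fintype.card {j : Fin N // j.1 < k} := by
    rw [Fintype.card_coe, hTc, Fintype.card_subtype]
    have := Fin.card_filter_val_lt (n := N) (m := k)
    simp_all
  let e := Fintype.equivOfCardEq hcard
  refine ⟨e.extendSubtype, fun j hj => ?_⟩
  exact e.extendSubtype_mem j (hT (by simpa using hj))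

/-- ww count of a colouring -/
def wc (N : ℕ) (c : Fin N → Bool) : ℕ :=
  (Finset.univ.filter fun i : Fin (N / 2) =>
    c ⟨2 * i.1, by have := i.isLt; omega⟩ = true ∧
    c ⟨2 * i.1 + 1, by have := i.isLt; omega⟩ = true).card

open Finset in
theorem result21_explicit (N k nbar : ℕ) (hN : Even N) (hNpos : 0 < N) (hk : k ≤ N) :
    epsWW N k nbar ≤ 2 * ∑ l ∈ Finset.range nbar,
      ((N / 2).choose l : ℝ) * ((k : ℝ) / N) ^ (2 * l) *
        (1 - ((k : ℝ) / N) ^ 2) ^ (N / 2 - l) := by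
  classical
  have hNM : N = N / 2 * 2 := by obtain ⟨r, hr⟩ := hN; omega
  have hmed := median_bound N k hNpos hk
  have hNr : (0:ℝ) < N := by exact_mod_cast hNpos
  set p : ℝ := (k:ℝ)/N with hp
  have hp0 : 0 ≤ p := by positivity
  have hp1 : p ≤ 1 := by rw [hp, div_le_one hNr]; exact_mod_cast hk
  let wb : Bool → ℝ := fun b => if b then p else 1 - p
  have wb0 : ∀ b, 0 ≤ wb b := by intro b; cases b <;> simp [wb, hp0, hp1]
  let w : (Fin N → Bool) → ℝ := fun c => ∏ j, wb (c j)
  have w0 : ∀ c, 0 ≤ w c := fun c => prod_nonneg fun j _ => wb0 _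
  -- binomial law of ww pairs
  have hX : ∑ c : Fin N → Bool, (if wc N c < nbar then w c else 0) =
      ∑ l ∈ range nbar, ((N / 2).choose l : ℝ) * p ^ (2 * l) * (1 - p ^ 2) ^ (N / 2 - l) := by
    have h := gen_count (fun b : Bool × Bool => wb b.1 * wb b.2)
      (fun b => b.1 = true ∧ b.2 = true) (N / 2) nbar
    have hA : (∑ a : Bool × Bool, if a.1 = true ∧ a.2 = true then wb a.1 * wb a.2 else 0) = p ^ 2 := by
      simp [Fintype.sum_prod_type, wb]; ring
    have hB : (∑ a : Bool × Bool, if a.1 = true ∧ a.2 = true then 0 else wb a.1 * wb a.2)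
        = 1 - p ^ 2 := by
      simp [Fintype.sum_prod_type, wb]; ring
    rw [hA, hB] at h
    simp only [pow_mul]
    rw [← h, ← (pairUp N (N/2) hNM).sum_comp]
    apply sum_congr rfl
    intro c _
    have : w c = ∏ i, (wb ((pairUp N (N/2) hNM) c i).1 * wb ((pairUp N (N/2) hNM) c i).2) :=
      prod_pair N (N/2) hNM (fun j => wb (c j))
    rw [this]
    rfl
  have hY : ∑ c : Fin N → Bool, (if (univ.filter fun j => c j = true).card < k + 1 then w c else 0) =
      ∑ i ∈ range (k + 1), (N.choose i : ℝ) * p ^ i * (1 - p) ^ (N - i) := by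
    have h := gen_count wb (fun b => b = true) N (k+1)
    rw [show w = fun c => ∏ j, wb (c j) from rfl, h]
    simp [wb]
  rw [← hX]
  rw [← hY] at hmed
  set Z := ∑ c : Fin N → Bool, (if wc N c < nbar then w c else 0)
  set Y := ∑ c : Fin N → Bool, (if (univ.filter fun j => c j = true).card < k + 1 then w c else 0)
  have hinv : ∀ σ : Equiv.Perm (Fin N),
      ∑ c : Fin N → Bool, (if wc N (c ∘ σ) < nbar then w c else 0) = Z := by
    intro σ
    rw [← (Equiv.arrowCongr σ (Equiv.refl Bool)).sum_comp]
    apply sum_congr rfl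
    intro c _
    have e1 : ((Equiv.arrowCongr σ (Equiv.refl Bool)) c) ∘ σ = c := by
      ext j; simp [Equiv.arrowCongr]
    have e2 : w ((Equiv.arrowCongr σ (Equiv.refl Bool)) c) = w c := by
      change ∏ j, wb (c (σ.symm j)) = ∏ j, wb (c j)
      exact σ.symm.prod_comp (fun j => wb (c j))
    rw [e1, e2]
  set E : ℝ := ((univ.filter fun σ : Equiv.Perm (Fin N) => wwCount N k σ < nbar).card : ℝ) with hE
  have hmain : Y * E ≤ (Fintype.card (Equiv.Perm (Fin N)) : ℝ) * Z := by
    have e : (Fintype.card (Equiv.Perm (Fin N)) : ℝ) * Z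
        = ∑ c : Fin N → Bool, ∑ σ : Equiv.Perm (Fin N), (if wc N (c ∘ σ) < nbar then w c else 0) := by
      rw [sum_comm, sum_congr rfl (fun σ _ => hinv σ)]
      simp
    rw [e, sum_mul]
    apply sum_le_sum
    intro c _
    split_ifs with hc
    · obtain ⟨τ, hτ⟩ := exists_perm_le N k hk c (by omega)
      have hE' : E = ∑ σ : Equiv.Perm (Fin N), (if wwCount N k (τ * σ) < nbar then (1:ℝ) else 0) := by
        have := Equiv.sum_comp (Equiv.mulLeft τ)
          (fun σ : Equiv.Perm (Fin N) => if wwCount N k σ < nbar then (1:ℝ) else 0)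
        simp only [Equiv.coe_mulLeft] at this
        refine Eq.trans ?_ (this.symm.trans (sum_congr rfl fun σ _ => by congr))
        rw [hE]; simp
      rw [hE', mul_sum]
      apply sum_le_sum
      intro σ _
      have hle : wc N (c ∘ σ) ≤ wwCount N k (τ * σ) := by
        apply card_le_card
        intro i
        simp only [mem_filter, mem_univ, true_and, Function.comp]
        exact fun h => ⟨hτ _ h.1, hτ _ h.2⟩
      by_cases h : wwCount N k (τ * σ) < nbar
      · rw [if_pos h, if_pos (lt_of_le_of_lt hle h), mul_one]
      · rw [if_neg h, mul_zero]; split_ifs; exact w0 c; exact le_rfl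
    · rw [zero_mul]
      apply sum_nonneg
      intro σ _
      split_ifs; exact w0 c; exact le_rfl
  have hcpos : (0:ℝ) < Fintype.card (Equiv.Perm (Fin N)) := by
    exact_mod_cast Fintype.card_pos
  have hE0 : 0 ≤ E := Nat.cast_nonneg _
  unfold epsWW
  rw [div_le_iff₀ hcpos]
  change E ≤ _
  nlinarith
end

section
/- Let N be an even positive integer and let k1, k2 be integers with 0 ≤ k2 ≤ k1 ≤ N/2. Then for every nonnegative integer n̄, the probability that a uniformly random grouping of [k2,N] produces strictly fewer than n̄+1 wb-pairs is at least the probability that a uniformly random grouping of [k1,N] produces strictly fewer than n̄ wb-pairs; that is, ε(n̄+1 | [k2,N]) ≥ ε(n̄ | [k1,N]). (Paper's Lemma 2.) -/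
/-- Number of wb-pairs (pairs with exactly one white ball): positions are grouped into
the pairs `{2i, 2i+1}`; the ball at position `j` is white iff `σ j < k`. A uniformly
random permutation `σ` of the `N` positions realizes a uniformly random grouping
(perfect matching) of a set of `k` white and `N - k` black balls. -/
def wbCount (N k : ℕ) (σ : Equiv.Perm (Fin N)) : ℕ :=
  (Finset.univ.filter fun i : Fin (N / 2) =>
    ((σ ⟨2 * i.1, by have := i.isLt; omega⟩).1 < k ∧
      ¬ (σ ⟨2 * i.1 + 1, by have := i.isLt; omega⟩).1 < k) ∨
    (¬ (σ ⟨2 * i.1, by have := i.isLt; omega⟩).1 < k ∧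
      (σ ⟨2 * i.1 + 1, by have := i.isLt; omega⟩).1 < k)).card

/-- ε(n̄ | [k,N]): the probability that a uniformly random grouping of `[k,N]`
produces strictly fewer than `n̄` wb-pairs. -/
noncomputable def epsWB (N k nbar : ℕ) : ℝ :=
  (Finset.univ.filter fun σ : Equiv.Perm (Fin N) => wbCount N k σ < nbar).card /
    (Fintype.card (Equiv.Perm (Fin N)))

namespace WB

open Finset

variable {α : Type*} [Fintype α] [DecidableEq α]

def W (f : α → Bool × Bool) : ℕ := ∑ i, ((f i).1.toNat + (f i).2.toNat)
def B (f : α → Bool × Bool) : ℕ := (univ.filter fun i => (f i).1 ≠ (f i).2).card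
def T (f : α → Bool × Bool) : ℕ := (univ.filter fun i => f i = (true, true)).card
def F (f : α → Bool × Bool) : ℕ := (univ.filter fun i => f i = (false, false)).card
def C (α : Type*) [Fintype α] [DecidableEq α] (k j : ℕ) : Finset (α → Bool × Bool) :=
  univ.filter fun f => W f = k ∧ B f = j

lemma W_eq (f : α → Bool × Bool) : W f = 2 * T f + B f := by
  simp only [W, T, B, card_filter, mul_sum, ← sum_add_distrib]
  apply sum_congr rfl
  intro i _
  rcases f i with ⟨_ | _, _ | _⟩ <;> simp

lemma card_eq (f : α → Bool × Bool) : Fintype.card α = T f + B f + F f := by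
  rw [← card_univ, card_eq_sum_ones]
  simp only [F, T, B, card_filter, ← sum_add_distrib]
  apply sum_congr rfl
  intro i _
  rcases f i with ⟨_ | _, _ | _⟩ <;> simp

lemma W_update (f : α → Bool × Bool) (i : α) (v : Bool × Bool) :
    W (Function.update f i v) + ((f i).1.toNat + (f i).2.toNat) =
      W f + (v.1.toNat + v.2.toNat) := by
  unfold W
  rw [← add_sum_erase _ _ (mem_univ i), ← add_sum_erase univ (fun i => (f i).1.toNat + (f i).2.toNat) (mem_univ i)]
  have : ∑ x ∈ univ.erase i, ((Function.update f i v x).1.toNat + (Function.update f i v x).2.toNat)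
      = ∑ x ∈ univ.erase i, ((f x).1.toNat + (f x).2.toNat) := by
    apply sum_congr rfl
    intro x hx
    rw [Function.update_of_ne (ne_of_mem_erase hx)]
  rw [this]
  simp
  omega

lemma B_update (f : α → Bool × Bool) (i : α) (v : Bool × Bool) (hv : v.1 = v.2)
    (hf : (f i).1 = (f i).2) :
    B (Function.update f i v) = B f := by
  unfold B
  congr 1
  ext x
  by_cases h : x = i
  · subst h; simp [hv, hf]
  · simp [Function.update_of_ne h]

lemma double (k j : ℕ) :
    ∑ f ∈ C α (k+2) j, T f = ∑ f ∈ C α k j, F f := by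
  unfold T F
  rw [← card_sigma, ← card_sigma]
  refine card_bij' (fun p _ => ⟨Function.update p.1 p.2 (false, false), p.2⟩)
    (fun p _ => ⟨Function.update p.1 p.2 (true, true), p.2⟩) ?_ ?_ ?_ ?_
  · rintro ⟨f, i⟩ h
    simp only [mem_sigma, C, mem_filter, mem_univ, true_and] at h ⊢
    obtain ⟨⟨h1, h2⟩, h3⟩ := h
    have := W_update f i (false, false)
    rw [h3] at this
    simp at this
    refine ⟨⟨by omega, ?_⟩, by simp⟩
    rw [B_update _ _ _ rfl (by rw [h3]), h2]
  · rintro ⟨f, i⟩ h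
    simp only [mem_sigma, C, mem_filter, mem_univ, true_and] at h ⊢
    obtain ⟨⟨h1, h2⟩, h3⟩ := h
    have := W_update f i (true, true)
    rw [h3] at this
    simp at this
    refine ⟨⟨by omega, ?_⟩, by simp⟩
    rw [B_update _ _ _ rfl (by rw [h3]), h2]
  · rintro ⟨f, i⟩ h
    simp only [mem_sigma, C, mem_filter, mem_univ, true_and] at h
    simp [← h.2]
  · rintro ⟨f, i⟩ h
    simp only [mem_sigma, C, mem_filter, mem_univ, true_and] at h
    simp [← h.2]

lemma ratio (k j : ℕ) :
    ((k : ℤ) + 2 - j) * (C α (k+2) j).card =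
      (2 * (Fintype.card α : ℤ) - k - j) * (C α k j).card := by
  have h := double (α := α) k j
  have h1 : ∑ f ∈ C α (k+2) j, (2 * (T f : ℤ)) = ((k : ℤ) + 2 - j) * (C α (k+2) j).card := by
    rw [mul_comm, ← nsmul_eq_mul, ← sum_const]
    apply sum_congr rfl
    intro f hf
    simp only [C, mem_filter] at hf
    have := W_eq f
    omega
  have h2 : ∑ f ∈ C α k j, (2 * (F f : ℤ)) =
      (2 * (Fintype.card α : ℤ) - k - j) * (C α k j).card := by
    rw [mul_comm, ← nsmul_eq_mul, ← sum_const]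
    apply sum_congr rfl
    intro f hf
    simp only [C, mem_filter] at hf
    have := W_eq f
    have := card_eq f
    omega
  rw [← h1, ← h2, ← mul_sum, ← mul_sum]
  exact_mod_cast congrArg (2 * ·) h

lemma mlr (k i j : ℕ) (hk : k + 1 ≤ Fintype.card α) (hij : j ≤ i) :
    (C α (k+2) j).card * (C α k i).card ≤ (C α (k+2) i).card * (C α k j).card := by
  by_cases hi : k < i
  · have : C α k i = ∅ := by
      rw [Finset.eq_empty_iff_forall_notMem]
      intro f hf
      simp only [C, mem_filter] at hf
      have := W_eq f
      omega
    simp [this]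
  push Not at hi
  have r1 := ratio (α := α) k j
  have r2 := ratio (α := α) k i
  zify at hk hij hi ⊢
  generalize ((C α (k+2) j).card : ℤ) = a at *
  generalize ((C α (k+2) i).card : ℤ) = b at *
  have hc : (0:ℤ) ≤ (C α k j).card := by positivity
  have hd : (0:ℤ) ≤ (C α k i).card := by positivity
  generalize ((C α k j).card : ℤ) = c at *
  generalize ((C α k i).card : ℤ) = d at *
  generalize (Fintype.card α : ℤ) = m at *
  generalize (k : ℤ) = k at *
  generalize (i : ℤ) = i at *
  generalize (j : ℤ) = j at *
  have hp : 0 < (k + 2 - j) * (k + 2 - i) := mul_pos (by linarith) (by linarith)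
  refine le_of_mul_le_mul_left ?_ hp
  have e1 : (k + 2 - j) * (k + 2 - i) * (a * d) = ((2*m-k-j) * (k+2-i)) * (c * d) := by
    linear_combination (k+2-i) * d * r1
  have e2 : (k + 2 - j) * (k + 2 - i) * (b * c) = ((2*m-k-i) * (k+2-j)) * (c * d) := by
    linear_combination (k+2-j) * c * r2
  rw [e1, e2]
  apply mul_le_mul_of_nonneg_right _ (mul_nonneg hc hd)
  nlinarith [mul_nonneg (sub_nonneg.2 hk) (sub_nonneg.2 hij)]

/-- colour vector of a permutation -/
def col (N k : ℕ) (σ : Equiv.Perm (Fin N)) : Fin (N/2) → Bool × Bool := fun i =>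
  (decide ((σ ⟨2 * i.1, by have := i.isLt; omega⟩).1 < k),
   decide ((σ ⟨2 * i.1 + 1, by have := i.isLt; omega⟩).1 < k))

lemma wb_eq (N k : ℕ) (σ : Equiv.Perm (Fin N)) : wbCount N k σ = B (col N k σ) := by
  unfold wbCount B col
  congr 1
  ext i
  simp only [mem_filter, mem_univ, true_and, ne_eq, decide_eq_decide]
  tauto

/-- flattening -/
def fl (N : ℕ) (hN : Even N) (f : Fin (N/2) → Bool × Bool) (x : Fin N) : Bool :=
  if x.1 % 2 = 0 then (f ⟨x.1 / 2, by have := x.2; have := hN.two_dvd; omega⟩).1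
  else (f ⟨x.1 / 2, by have := x.2; have := hN.two_dvd; omega⟩).2

lemma fl_even (N : ℕ) (hN : Even N) (f : Fin (N/2) → Bool × Bool) (i : Fin (N/2)) :
    fl N hN f ⟨2 * i.1, by have := i.isLt; omega⟩ = (f i).1 := by
  simp [fl]

lemma fl_odd (N : ℕ) (hN : Even N) (f : Fin (N/2) → Bool × Bool) (i : Fin (N/2)) :
    fl N hN f ⟨2 * i.1 + 1, by have := i.isLt; omega⟩ = (f i).2 := by
  have : (2 * i.1 + 1) / 2 = i.1 := by omega
  simp [fl, this]

lemma fl_col (N : ℕ) (hN : Even N) (k : ℕ) (σ : Equiv.Perm (Fin N)) (x : Fin N) :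
    fl N hN (col N k σ) x = decide ((σ x).1 < k) := by
  unfold fl col
  split_ifs with h
  · have : (⟨2 * (x.1/2), by omega⟩ : Fin N) = x := by ext; simp; omega
    simp [this]
  · have : (⟨2 * (x.1/2) + 1, by omega⟩ : Fin N) = x := by ext; simp; omega
    simp [this]

lemma col_eq_iff (N : ℕ) (hN : Even N) (k : ℕ) (σ : Equiv.Perm (Fin N)) (f) :
    col N k σ = f ↔ ∀ x, decide ((σ x).1 < k) = fl N hN f x := by
  constructor
  · rintro rfl x
    rw [fl_col]
  · intro h
    funext i
    ext1
    · rw [← fl_even N hN f, ← h]; rfl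
    · rw [← fl_odd N hN f, ← h]; rfl

def eqv (N : ℕ) (hN : Even N) : Fin (N/2) × Bool ≃ Fin N where
  toFun p := ⟨2 * p.1.1 + p.2.toNat, by
    have := p.1.2; rcases p with ⟨_, _ | _⟩ <;> simp at * <;> omega⟩
  invFun x := (⟨x.1 / 2, by have := x.2; have := hN.two_dvd; omega⟩, decide (x.1 % 2 = 1))
  left_inv := by
    rintro ⟨i, _ | _⟩
    · simp
    · ext
      · simp; omega
      · simp
  right_inv := by
    intro x
    ext
    rcases Nat.mod_two_eq_zero_or_one x.1 with h | h <;> simp [h] <;> omega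

lemma W_fl (N : ℕ) (hN : Even N) (f : Fin (N/2) → Bool × Bool) :
    Fintype.card {x // fl N hN f x = true} = W f := by
  rw [Fintype.card_subtype, card_filter, ← (eqv N hN).sum_comp, Fintype.sum_prod_type]
  unfold W
  apply sum_congr rfl
  intro i _
  have h1 := fl_even N hN f i
  have h2 := fl_odd N hN f i
  simp [eqv, h1, h2]
  rcases f i with ⟨_ | _, _ | _⟩ <;> simp

lemma W_col (N : ℕ) (hN : Even N) (k : ℕ) (hk : k ≤ N) (σ : Equiv.Perm (Fin N)) :
    W (col N k σ) = k := by
  rw [← W_fl N hN, Fintype.card_subtype]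
  simp only [fl_col, decide_eq_true_eq]
  rw [card_filter, Equiv.sum_comp σ (fun y : Fin N => if y.1 < k then 1 else 0), ← card_filter]
  have := Fin.card_filter_val_lt (n := N) (m := k)
  simpa [hk] using this

def fib (N k : ℕ) (f : Fin (N/2) → Bool × Bool) : ℕ :=
  (univ.filter fun σ : Equiv.Perm (Fin N) => col N k σ = f).card

lemma fib_le (N : ℕ) (hN : Even N) (k : ℕ) (f g : Fin (N/2) → Bool × Bool) (h : W f = W g) :
    fib N k f ≤ fib N k g := by
  rw [← W_fl N hN, ← W_fl N hN] at h
  let e := Fintype.equivOfCardEq h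
  let τ : Equiv.Perm (Fin N) := e.extendSubtype
  have hτ : ∀ x, fl N hN g (τ x) = fl N hN f x := by
    intro x
    by_cases hx : fl N hN f x = true
    · rw [hx]; exact e.extendSubtype_mem x hx
    · have := e.extendSubtype_not_mem x hx
      simp only [Bool.not_eq_true] at hx this
      rw [hx]; exact this
  apply card_le_card_of_injOn (fun σ => τ.symm.trans σ)
  · intro σ hσ
    simp only [coe_filter, mem_univ, true_and, Set.mem_ofPred_eq, col_eq_iff N hN] at hσ ⊢
    intro x
    have := hσ (τ.symm x)
    rw [← hτ, τ.apply_symm_apply] at this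
    exact this
  · intro σ _ σ' _ hh
    ext1 x
    have := congrArg (fun s : Equiv.Perm (Fin N) => s (τ x)) hh
    simpa using this

lemma exists_fib (N : ℕ) (hN : Even N) (k : ℕ) :
    ∃ φ : ℕ, ∀ f, W f = k → fib N k f = φ := by
  by_cases h : ∃ f : Fin (N/2) → Bool × Bool, W f = k
  · obtain ⟨f, hf⟩ := h
    exact ⟨fib N k f, fun g hg => le_antisymm (fib_le N hN k _ _ (by omega))
      (fib_le N hN k _ _ (by omega))⟩
  · push Not at h
    exact ⟨0, fun f hf => absurd hf (h f)⟩

def p (N k j : ℕ) : ℕ := (univ.filter fun σ : Equiv.Perm (Fin N) => wbCount N k σ = j).card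

lemma p_eq (N : ℕ) (hN : Even N) (k : ℕ) (hk : k ≤ N) :
    ∃ φ : ℕ, ∀ j, p N k j = φ * (C (Fin (N/2)) k j).card := by
  obtain ⟨φ, hφ⟩ := exists_fib N hN k
  refine ⟨φ, fun j => ?_⟩
  unfold p
  rw [card_eq_sum_card_fiberwise (f := col N k) (t := C (Fin (N/2)) k j)]
  · rw [mul_comm, ← smul_eq_mul, ← sum_const]
    apply sum_congr rfl
    intro f hf
    simp only [C, mem_filter, mem_univ, true_and] at hf
    rw [← hφ f hf.1]
    unfold fib
    congr 1
    ext σ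
    simp only [mem_filter, mem_univ, true_and, wb_eq]
    constructor
    · exact fun h => h.2
    · rintro rfl; exact ⟨hf.2, rfl⟩
  · intro σ hσ
    simp only [coe_filter, mem_univ, true_and, Set.mem_ofPred_eq, C, wb_eq] at hσ ⊢
    exact ⟨W_col N hN k hk σ, hσ⟩

lemma p_mlr (N : ℕ) (hN : Even N) (k i j : ℕ) (hk : k + 2 ≤ N / 2) (hij : j ≤ i) :
    p N (k+2) j * p N k i ≤ p N (k+2) i * p N k j := by
  obtain ⟨φ, h1⟩ := p_eq N hN k (by omega)
  obtain ⟨ψ, h2⟩ := p_eq N hN (k+2) (by omega)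
  rw [h1, h1, h2, h2]
  have := mlr (α := Fin (N/2)) k i j (by simp; omega) hij
  calc _ = ψ * φ * ((C (Fin (N/2)) (k+2) j).card * (C (Fin (N/2)) k i).card) := by ring
    _ ≤ ψ * φ * ((C (Fin (N/2)) (k+2) i).card * (C (Fin (N/2)) k j).card) :=
      Nat.mul_le_mul_left _ this
    _ = _ := by ring

def A (N k n : ℕ) : ℕ := (univ.filter fun σ : Equiv.Perm (Fin N) => wbCount N k σ < n).card

lemma A_eq (N k n : ℕ) : A N k n = ∑ j ∈ range n, p N k j := by
  unfold A p
  rw [card_eq_sum_card_fiberwise (f := wbCount N k) (t := range n)]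
  · apply sum_congr rfl
    intro j hj
    congr 1
    ext σ
    simp only [mem_filter, mem_univ, true_and, mem_range] at hj ⊢
    omega
  · intro σ hσ
    simpa using hσ

lemma wb_le (N k : ℕ) (σ) : wbCount N k σ < N + 1 := by
  have := card_filter_le (univ : Finset (Fin (N/2))) (fun i : Fin (N / 2) =>
    ((σ ⟨2 * i.1, by have := i.isLt; omega⟩).1 < k ∧
      ¬ (σ ⟨2 * i.1 + 1, by have := i.isLt; omega⟩).1 < k) ∨
    (¬ (σ ⟨2 * i.1, by have := i.isLt; omega⟩).1 < k ∧
      (σ ⟨2 * i.1 + 1, by have := i.isLt; omega⟩).1 < k))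
  simp only [card_univ, Fintype.card_fin] at this
  unfold wbCount
  omega

lemma A_top (N k n : ℕ) (hn : N + 1 ≤ n) : A N k n = Fintype.card (Equiv.Perm (Fin N)) := by
  unfold A
  rw [filter_true_of_mem, card_univ]
  intro σ _
  exact (wb_le N k σ).trans_le hn

lemma A_two (N : ℕ) (hN : Even N) (k n : ℕ) (hk : k + 2 ≤ N / 2) :
    A N (k+2) n ≤ A N k n := by
  by_cases hn : N + 1 ≤ n
  · rw [A_top _ _ _ hn, A_top _ _ _ hn]
  push Not at hn
  have t1 := A_top N k (N+1) le_rfl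
  have t2 := A_top N (k+2) (N+1) le_rfl
  have hpos : 0 < Fintype.card (Equiv.Perm (Fin N)) := Fintype.card_pos
  rw [A_eq, ← sum_range_add_sum_Ico _ hn.le, ← A_eq] at t1 t2
  have key : A N (k+2) n * ∑ i ∈ Ico n (N+1), p N k i ≤
      (∑ i ∈ Ico n (N+1), p N (k+2) i) * A N k n := by
    rw [A_eq, A_eq, sum_mul_sum, sum_mul_sum, sum_comm]
    apply sum_le_sum
    intro i hi
    apply sum_le_sum
    intro j hj
    simp only [mem_Ico, mem_range] at hi hj
    exact p_mlr N hN k i j hk (by omega)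
  nlinarith

lemma A_mono (N : ℕ) (k n : ℕ) {m : ℕ} (h : n ≤ m) : A N k n ≤ A N k m := by
  apply card_le_card
  intro σ
  simp only [mem_filter, mem_univ, true_and]
  omega

lemma A_one (N : ℕ) (hN : Even N) (k n : ℕ) (hk : k + 1 ≤ N / 2) :
    A N (k+1) n ≤ A N k (n+1) := by
  apply card_le_card
  intro σ
  simp only [mem_filter, mem_univ, true_and]
  suffices wbCount N k σ ≤ wbCount N (k+1) σ + 1 by omega
  let x := σ.symm ⟨k, by omega⟩
  have hx : ∀ y, (σ y).1 = k → y = x := by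
    intro y hy
    rw [Equiv.eq_symm_apply]
    ext; exact hy
  let i0 : Fin (N/2) := ⟨x.1 / 2, by have := x.2; have := hN.two_dvd; omega⟩
  unfold wbCount
  refine (card_le_card ?_).trans (card_insert_le i0 _)
  intro i hi
  simp only [mem_insert, mem_filter, mem_univ, true_and] at hi ⊢
  by_cases h : i = i0
  · exact Or.inl h
  right
  have h1 : (σ ⟨2 * i.1, by have := i.isLt; omega⟩).1 ≠ k := by
    intro hh
    have := congrArg Fin.val (hx _ hh)
    apply h; ext; simp only [i0] at *; omega
  have h2 : (σ ⟨2 * i.1 + 1, by have := i.isLt; omega⟩).1 ≠ k := by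
    intro hh
    have := congrArg Fin.val (hx _ hh)
    apply h; ext; simp only [i0] at *; omega
  omega

lemma A_even (N : ℕ) (hN : Even N) (k n d : ℕ) (hk : k + 2 * d ≤ N / 2) :
    A N (k + 2 * d) n ≤ A N k n := by
  induction d with
  | zero => exact le_rfl
  | succ d ih => exact (A_two N hN (k + 2 * d) n (by omega)).trans (ih (by omega))

lemma A_main (N k1 k2 n : ℕ) (hN : Even N) (hk21 : k2 ≤ k1) (hk1 : k1 ≤ N / 2) :
    A N k1 n ≤ A N k2 (n + 1) := by
  obtain ⟨d, rfl⟩ := Nat.exists_eq_add_of_le hk21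
  rcases Nat.even_or_odd' d with ⟨e, rfl | rfl⟩
  · exact (A_even N hN k2 n e hk1).trans (A_mono N k2 n (by omega))
  · have h := A_even N hN (k2 + 1) n e (by omega)
    rw [show k2 + (2 * e + 1) = k2 + 1 + 2 * e by ring]
    exact h.trans (A_one N hN k2 n (by omega))

end WB

/-- Paper's Lemma 2: if `0 ≤ k2 ≤ k1 ≤ N/2`, then for every `n̄`,
ε(n̄+1 | [k2,N]) ≥ ε(n̄ | [k1,N]) (for wb-pairs). -/
theorem lemma2_wb (N k1 k2 nbar : ℕ) (hN : Even N) (hNpos : 0 < N)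
    (hk21 : k2 ≤ k1) (hk1 : k1 ≤ N / 2) :
    epsWB N k1 nbar ≤ epsWB N k2 (nbar + 1) := by
  have h := WB.A_main N k1 k2 nbar hN hk21 hk1
  unfold WB.A at h
  unfold epsWB
  apply div_le_div_of_nonneg_right _ (by positivity)
  exact_mod_cast h
end

section
/- Let n, k, n̄_e be nonnegative integers with 2 n̄_e + 1 < 2k ≤ n − 1. Then for a uniformly random grouping of 2n balls, the probability of producing strictly fewer than 2 n̄_e + 1 wb-pairs when 2k of the balls are white is at least the corresponding probability when 2k+1 of the balls are white: ε(2 n̄_e + 1 | [2k, 2n]) ≥ ε(2 n̄_e + 1 | [2k+1, 2n]). (Paper's Eq. (pr1).) -/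
/-- White indicator of a position. -/
def wInd (N k : ℕ) (σ : Equiv.Perm (Fin N)) (j : ℕ) : ℕ :=
  if h : j < N then (if (σ ⟨j, h⟩).1 < k then 1 else 0) else 0

theorem sum_pairs (f : ℕ → ℕ) (n : ℕ) :
    ∑ j ∈ Finset.range (2 * n), f j = ∑ i ∈ Finset.range n, (f (2 * i) + f (2 * i + 1)) := by
  induction n with
  | zero => simp
  | succ n ih =>
    rw [show 2 * (n + 1) = 2 * n + 1 + 1 by ring, Finset.sum_range_succ, Finset.sum_range_succ, ih,
      Finset.sum_range_succ]
    ring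

theorem sum_wInd (N k : ℕ) (hk : k ≤ N) (σ : Equiv.Perm (Fin N)) :
    ∑ j ∈ Finset.range N, wInd N k σ j = k := by
  rw [Finset.sum_range]
  have : ∀ i : Fin N, wInd N k σ i = (fun x : Fin N => if x.1 < k then 1 else 0) (σ i) := by
    intro i
    simp [wInd]
  rw [Finset.sum_congr rfl (fun i _ => this i), Equiv.sum_comp σ (fun x : Fin N => if x.1 < k then 1 else 0),
    ← Finset.sum_range (fun x : ℕ => if x < k then 1 else 0), ← Finset.card_filter]
  have : (Finset.range N).filter (fun x => x < k) = Finset.range k := by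
    ext x
    simp only [Finset.mem_filter, Finset.mem_range]
    omega
  rw [this, Finset.card_range]

theorem wbCount_parity (n k : ℕ) (hk : k ≤ 2 * n) (σ : Equiv.Perm (Fin (2 * n))) :
    wbCount (2 * n) k σ % 2 = k % 2 := by
  have h := sum_wInd (2 * n) k hk σ
  have h2 : 2 * n = 2 * (2 * n / 2) := by omega
  have h3 : ∑ j ∈ Finset.range (2 * (2 * n / 2)), wInd (2 * n) k σ j = k := by
    rw [← h2]; exact h
  rw [sum_pairs, Finset.sum_range] at h3
  conv_rhs => rw [← h3]
  unfold wbCount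
  rw [Finset.card_filter, Finset.sum_nat_mod]
  conv_rhs => rw [Finset.sum_nat_mod]
  congr 1
  apply Finset.sum_congr rfl
  intro i _
  have hi := i.isLt
  have a1 : 2 * i.1 < 2 * n := by omega
  have a2 : 2 * i.1 + 1 < 2 * n := by omega
  simp only [wInd, a1, a2, dif_pos]
  split_ifs <;> omega

theorem wbCount_step (n k : ℕ) (hk : k < 2 * n) (σ : Equiv.Perm (Fin (2 * n))) :
    wbCount (2 * n) k σ ≤ wbCount (2 * n) (k + 1) σ + 1 := by
  have hp := (σ.symm ⟨k, hk⟩).isLt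
  let i0 : Fin (2 * n / 2) := ⟨(σ.symm ⟨k, hk⟩).1 / 2, by omega⟩
  unfold wbCount
  refine le_trans (Finset.card_le_card ?_) (Finset.card_insert_le i0 _)
  intro i hi
  rw [Finset.mem_insert]
  by_cases hii : i = i0
  · exact Or.inl hii
  right
  have key : ∀ j : Fin (2 * n), j.1 / 2 = i.1 → (σ j).1 ≠ k := by
    intro j hj hc
    apply hii
    have : j = σ.symm ⟨k, hk⟩ := by
      rw [Equiv.eq_symm_apply]; exact Fin.ext hc
    apply Fin.ext
    rw [← hj, this]
  have hl := i.isLt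
  have k1 := key ⟨2 * i.1, by omega⟩ (by simp)
  have k2 := key ⟨2 * i.1 + 1, by omega⟩ (by simp; omega)
  simp only [Finset.mem_filter, Finset.mem_univ, true_and] at hi ⊢
  omega

/-- Paper's Eq. (pr1): if `2 n̄_e + 1 < 2k ≤ n - 1` then
ε(2 n̄_e + 1 | [2k, 2n]) ≥ ε(2 n̄_e + 1 | [2k+1, 2n]) (for wb-pairs). -/
theorem pr1_wb (n k ne : ℕ) (h1 : 2 * ne + 1 < 2 * k) (h2 : 2 * k ≤ n - 1) :
    epsWB (2 * n) (2 * k + 1) (2 * ne + 1) ≤ epsWB (2 * n) (2 * k) (2 * ne + 1) := by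
  unfold epsWB
  apply div_le_div_of_nonneg_right _ (Nat.cast_nonneg _)
  apply Nat.cast_le.mpr
  apply Finset.card_le_card
  intro σ hσ
  simp only [Finset.mem_filter, Finset.mem_univ, true_and] at hσ ⊢
  have p := wbCount_parity n (2 * k + 1) (by omega) σ
  have s := wbCount_step n (2 * k) (by omega) σ
  omega
end

section
/- Let n, k, n̄_e be nonnegative integers with 2 n̄_e + 1 < 2k ≤ n − 1. Then for a uniformly random grouping of 2n balls, the probability of producing strictly fewer than 2 n̄_e + 1 wb-pairs when 2k of the balls are white is at least the corresponding probability when 2k+2 of the balls are white: ε(2 n̄_e + 1 | [2k, 2n]) ≥ ε(2 n̄_e + 1 | [2k+2, 2n]). (Paper's Eq. (pr2).) -/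
def wbS (n : ℕ) (S : Finset ℕ) : ℕ :=
  ((Finset.range n).filter fun i => (2*i ∈ S ∧ 2*i+1 ∉ S) ∨ (2*i ∉ S ∧ 2*i+1 ∈ S)).card

def wwS (n : ℕ) (S : Finset ℕ) : ℕ :=
  ((Finset.range n).filter fun i => 2*i ∈ S ∧ 2*i+1 ∈ S).card

def bbS (n : ℕ) (S : Finset ℕ) : ℕ :=
  ((Finset.range n).filter fun i => 2*i ∉ S ∧ 2*i+1 ∉ S).card

def FS (n K w : ℕ) : Finset (Finset ℕ) :=
  ((Finset.range (2*n)).powersetCard K).filter fun S => wbS n S = w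

lemma cardS_aux (n : ℕ) (S : Finset ℕ) :
    ((Finset.range (2*n)).filter (· ∈ S)).card = 2 * wwS n S + wbS n S := by
  unfold wwS wbS
  simp only [Finset.card_filter]
  induction n with
  | zero => simp
  | succ n ih =>
    rw [show 2*(n+1) = 2*n+1+1 by ring]
    simp only [Finset.sum_range_succ]
    rw [ih]
    by_cases h : 2*n ∈ S <;> by_cases h' : 2*n+1 ∈ S <;> simp [h, h'] <;> ring

lemma cardS (n : ℕ) (S : Finset ℕ) (h : S ⊆ Finset.range (2*n)) :
    S.card = 2 * wwS n S + wbS n S := by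
  rw [← cardS_aux]
  congr 1
  ext x
  simp only [Finset.mem_filter]
  exact ⟨fun hx => ⟨h hx, hx⟩, fun hx => hx.2⟩

lemma totS (n : ℕ) (S : Finset ℕ) : wwS n S + bbS n S + wbS n S = n := by
  unfold wwS wbS bbS
  simp only [Finset.card_filter]
  induction n with
  | zero => simp
  | succ n ih =>
    simp only [Finset.sum_range_succ]
    by_cases h : 2*n ∈ S <;> by_cases h' : 2*n+1 ∈ S <;>
      simp [h, h', -Finset.sum_boole, -Finset.card_filter] <;> omega

lemma dbl (n K w : ℕ) : ∑ S ∈ FS n K w, bbS n S = ∑ S ∈ FS n (K+2) w, wwS n S := by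
  unfold bbS wwS
  simp only [Finset.card_filter]
  rw [Finset.sum_comm]
  conv_rhs => rw [Finset.sum_comm]
  refine Finset.sum_congr rfl fun i hi => ?_
  rw [← Finset.card_filter, ← Finset.card_filter]
  have hi' := Finset.mem_range.1 hi
  refine Finset.card_bij' (fun S _ => insert (2*i) (insert (2*i+1) S))
    (fun S _ => (S.erase (2*i)).erase (2*i+1)) ?_ ?_ ?_ ?_
  · intro S hS
    simp only [FS, Finset.mem_filter, Finset.mem_powersetCard] at hS ⊢
    obtain ⟨⟨⟨hsub, hc⟩, hw⟩, h1, h2⟩ := hS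
    refine ⟨⟨⟨?_, ?_⟩, ?_⟩, by simp, by simp⟩
    · intro x hx
      simp only [Finset.mem_insert] at hx
      rcases hx with rfl | rfl | hx
      · simp; omega
      · simp; omega
      · exact hsub hx
    · rw [Finset.card_insert_of_notMem (by simp [h1]), Finset.card_insert_of_notMem h2, hc]
    · rw [← hw]
      unfold wbS
      congr 1
      refine Finset.filter_congr fun j hj => ?_
      by_cases hij : j = i
      · subst hij; simp [h1, h2]
      · have a1 : 2*j ≠ 2*i := by omega
        have a2 : 2*j ≠ 2*i+1 := by omega
        have a3 : 2*j+1 ≠ 2*i := by omega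
        have a4 : 2*j+1 ≠ 2*i+1 := by omega
        simp only [Finset.mem_insert, a1, a2, a3, a4, false_or]
  · intro S hS
    simp only [FS, Finset.mem_filter, Finset.mem_powersetCard] at hS ⊢
    obtain ⟨⟨⟨hsub, hc⟩, hw⟩, h1, h2⟩ := hS
    refine ⟨⟨⟨?_, ?_⟩, ?_⟩, by simp, by simp⟩
    · intro x hx
      exact hsub (Finset.mem_of_mem_erase (Finset.mem_of_mem_erase hx))
    · rw [Finset.card_erase_of_mem (by simp [h2]), Finset.card_erase_of_mem h1, hc]
      omega
    · rw [← hw]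
      unfold wbS
      congr 1
      refine Finset.filter_congr fun j hj => ?_
      by_cases hij : j = i
      · subst hij; simp [h1, h2]
      · have a1 : 2*j ≠ 2*i := by omega
        have a2 : 2*j ≠ 2*i+1 := by omega
        have a3 : 2*j+1 ≠ 2*i := by omega
        have a4 : 2*j+1 ≠ 2*i+1 := by omega
        simp only [Finset.mem_erase, ne_eq, a1, a2, a3, a4, not_false_eq_true, true_and]
  · intro S hS
    simp only [FS, Finset.mem_filter] at hS
    ext x
    simp only [Finset.mem_erase, Finset.mem_insert]
    grind
  · intro S hS
    simp only [FS, Finset.mem_filter] at hS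
    ext x
    simp only [Finset.mem_erase, Finset.mem_insert]
    grind

lemma ratioS (n K w : ℕ) :
    ((FS n (K+2) w).card : ℤ) * (K + 2 - w) = (FS n K w).card * (2*n - K - w) := by
  have h := congrArg (fun x : ℕ => (2:ℤ) * (x:ℤ)) (dbl n K w)
  simp only [Nat.cast_sum, Finset.mul_sum] at h
  have e1 : ∀ S ∈ FS n K w, (2:ℤ) * (bbS n S : ℤ) = 2*n - K - w := by
    intro S hS
    simp only [FS, Finset.mem_filter, Finset.mem_powersetCard] at hS
    have := cardS n S hS.1.1
    have := totS n S
    omega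
  have e2 : ∀ S ∈ FS n (K+2) w, (2:ℤ) * (wwS n S : ℤ) = K + 2 - w := by
    intro S hS
    simp only [FS, Finset.mem_filter, Finset.mem_powersetCard] at hS
    have := cardS n S hS.1.1
    omega
  rw [Finset.sum_congr rfl e1, Finset.sum_congr rfl e2] at h
  simp only [Finset.sum_const, nsmul_eq_mul] at h
  exact h.symm

lemma FS_zero (n K w : ℕ) (h : K < w) : (FS n K w).card = 0 := by
  rw [Finset.card_eq_zero, Finset.eq_empty_iff_forall_notMem]
  intro S hS
  simp only [FS, Finset.mem_filter, Finset.mem_powersetCard] at hS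
  have := cardS n S hS.1.1
  omega

lemma mlr (n K u v : ℕ) (hK : K + 1 ≤ n) (huv : u ≤ v) :
    (FS n (K+2) u).card * (FS n K v).card ≤ (FS n K u).card * (FS n (K+2) v).card := by
  rcases lt_or_ge K v with hv | hv
  · simp [FS_zero n K v hv]
  have hu := ratioS n K u
  have hv' := ratioS n K v
  zify
  generalize ((FS n (K+2) u).card : ℤ) = bu at *
  generalize ((FS n (K+2) v).card : ℤ) = bv at *
  have au0 : (0:ℤ) ≤ (FS n K u).card := by positivity
  have av0 : (0:ℤ) ≤ (FS n K v).card := by positivity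
  generalize ((FS n K u).card : ℤ) = au at *
  generalize ((FS n K v).card : ℤ) = av at *
  have p1 : (0:ℤ) < (K + 2 - u) := by omega
  have p2 : (0:ℤ) < (K + 2 - v) := by omega
  refine le_of_mul_le_mul_right ?_ (mul_pos p1 p2)
  have d1 : (0:ℤ) ≤ (2*n-K) - (K+2) := by omega
  have d2 : (0:ℤ) ≤ (v:ℤ) - u := by omega
  have key : 0 ≤ au * av * (((2*n-K) - (K+2)) * ((v:ℤ) - u)) := by positivity
  have l : bu * av * ((K + 2 - u) * (K + 2 - v)) = au * (2*n-K-u) * av * (K+2-v) := by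
    rw [← hu]; ring
  have r : au * bv * ((K + 2 - u) * (K + 2 - v)) = au * (av * (2*n-K-v)) * (K+2-u) := by
    rw [← hv']; ring
  rw [l, r]
  linarith

def LS (n K m : ℕ) : Finset (Finset ℕ) :=
  ((Finset.range (2*n)).powersetCard K).filter fun S => wbS n S < m

lemma LS_card (n K m : ℕ) : (LS n K m).card = ∑ w ∈ Finset.range m, (FS n K w).card := by
  rw [Finset.card_eq_sum_card_fiberwise (f := wbS n) (t := Finset.range m)]
  · refine Finset.sum_congr rfl fun w hw => ?_
    congr 1
    ext S
    simp only [LS, FS, Finset.mem_filter, Finset.mem_range] at *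
    constructor
    · rintro ⟨⟨a, b⟩, c⟩; exact ⟨a, c⟩
    · rintro ⟨a, b⟩; exact ⟨⟨a, by omega⟩, b⟩
  · intro S hS
    simp only [LS, Finset.coe_filter, Set.mem_ofPred_eq] at hS
    simpa using hS.2

lemma tot_LS (n K m : ℕ) (hm : n < m) : (LS n K m).card = (2*n).choose K := by
  have : LS n K m = (Finset.range (2*n)).powersetCard K := by
    refine Finset.filter_true_of_mem fun S _ => ?_
    have := totS n S
    omega
  rw [this, Finset.card_powersetCard, Finset.card_range]

lemma dom (n K m : ℕ) (hK : K + 1 ≤ n) :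
    (LS n (K+2) m).card * (2*n).choose K ≤ (LS n K m).card * (2*n).choose (K+2) := by
  rw [← tot_LS n K (m+(n+1)) (by omega), ← tot_LS n (K+2) (m+(n+1)) (by omega)]
  simp only [LS_card, Finset.sum_range_add _ m (n+1)]
  rw [mul_add, mul_add, mul_comm (∑ w ∈ Finset.range m, (FS n (K+2) w).card)]
  refine Nat.add_le_add_left ?_ _
  rw [Finset.sum_mul_sum, Finset.sum_mul_sum]
  refine Finset.sum_le_sum fun u hu => Finset.sum_le_sum fun v hv => ?_
  have := Finset.mem_range.1 hu
  exact mlr n K u _ hK (by omega)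

def pre (N K : ℕ) (σ : Equiv.Perm (Fin N)) : Finset (Fin N) :=
  Finset.univ.filter fun x => (σ x).1 < K

lemma pre_card (N K : ℕ) (h : K ≤ N) (σ : Equiv.Perm (Fin N)) : (pre N K σ).card = K := by
  have : pre N K σ = (Finset.univ.filter fun x : Fin N => x.1 < K).map σ.symm.toEmbedding := by
    ext x; simp [pre, Finset.mem_map_equiv]
  rw [this, Finset.card_map, Fin.card_filter_val_lt]
  omega

lemma fib_le (N K : ℕ) (S T : Finset (Fin N)) (hST : S.card = T.card) :
    (Finset.univ.filter fun σ => pre N K σ = S).card ≤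
    (Finset.univ.filter fun σ => pre N K σ = T).card := by
  have e0 : {x // x ∈ T} ≃ {x // x ∈ S} := Fintype.equivOfCardEq (by simp [hST])
  let e := e0.extendSubtype
  have he : ∀ x, e x ∈ S ↔ x ∈ T := fun x => by
    constructor
    · intro h
      by_contra hx
      exact e0.extendSubtype_not_mem x hx h
    · exact e0.extendSubtype_mem x
  refine Finset.card_le_card_of_injOn (fun σ => e.trans σ) ?_ ?_
  · intro σ hσ
    simp only [Finset.coe_filter, Finset.mem_univ, true_and, Set.mem_ofPred_eq] at hσ ⊢
    ext x
    rw [← he, ← hσ]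
    simp only [pre, Finset.mem_filter, Finset.mem_univ, true_and]
    rfl
  · intro σ _ τ _ h
    ext x
    have := congrArg (fun f : Equiv.Perm (Fin N) => f (e.symm x)) h
    simpa using congrArg Fin.val this

lemma unif (N K : ℕ) (h : K ≤ N) (P : Finset (Fin N) → Prop) [DecidablePred P] :
    (Finset.univ.filter fun σ => P (pre N K σ)).card * N.choose K =
    Fintype.card (Equiv.Perm (Fin N)) *
      (((Finset.univ : Finset (Fin N)).powersetCard K).filter P).card := by
  obtain ⟨T, -, hT⟩ := Finset.exists_subset_card_eq (s := (Finset.univ : Finset (Fin N)))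
    (n := K) (by simpa using h)
  have main : ∀ (Q : Finset (Fin N) → Prop) [DecidablePred Q],
      (Finset.univ.filter fun σ => Q (pre N K σ)).card =
      (((Finset.univ : Finset (Fin N)).powersetCard K).filter Q).card *
        (Finset.univ.filter fun σ => pre N K σ = T).card := by
    intro Q _
    rw [Finset.card_eq_sum_card_fiberwise (f := pre N K)
      (t := ((Finset.univ : Finset (Fin N)).powersetCard K).filter Q)]
    · rw [← smul_eq_mul, ← Finset.sum_const]
      refine Finset.sum_congr rfl fun S hS => ?_
      simp only [Finset.mem_filter, Finset.mem_powersetCard] at hS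
      have : (Finset.univ.filter fun σ => Q (pre N K σ)).filter (fun σ => pre N K σ = S) =
          Finset.univ.filter fun σ => pre N K σ = S := by
        ext σ
        simp only [Finset.mem_filter, Finset.mem_univ, true_and]
        constructor
        · exact fun h => h.2
        · exact fun h => ⟨h ▸ hS.2, h⟩
      rw [this]
      exact le_antisymm (fib_le N K S T (by omega)) (fib_le N K T S (by omega))
    · intro σ hσ
      simp only [Finset.coe_filter, Finset.mem_univ, true_and, Set.mem_ofPred_eq] at hσ
      simp [hσ, pre_card N K h σ, Finset.mem_powersetCard]
  have t := main (fun _ => True)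
  simp only [Finset.filter_true, Finset.card_univ, Finset.card_powersetCard,
    Fintype.card_fin] at t
  rw [main P, t]
  ring

lemma wb_eq (n K : ℕ) (σ : Equiv.Perm (Fin (2*n))) :
    wbCount (2*n) K σ = wbS n ((pre (2*n) K σ).map Fin.valEmbedding) := by
  unfold wbCount wbS
  refine Finset.card_bij (fun i _ => i.1) ?_ ?_ ?_
  · intro i hi
    have := i.2
    have b0 : i.1 < n := by omega
    have b1 : 2*i.1 < 2*n := by omega
    have b2 : 2*i.1+1 < 2*n := by omega
    simpa [pre, Fin.exists_iff, b0, b1, b2] using hi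
  · intro i _ j _ h
    exact Fin.ext h
  · intro i hi
    have b0 : i < n := Finset.mem_range.1 (Finset.mem_filter.1 hi).1
    have b1 : 2*i < 2*n := by omega
    have b2 : 2*i+1 < 2*n := by omega
    refine ⟨⟨i, by omega⟩, ?_, rfl⟩
    simpa [pre, Fin.exists_iff, b0, b1, b2] using hi

lemma LS_eq (n K m : ℕ) :
    (((Finset.univ : Finset (Fin (2*n))).powersetCard K).filter
      fun S => wbS n (S.map Fin.valEmbedding) < m).card = (LS n K m).card := by
  have : LS n K m = (((Finset.univ : Finset (Fin (2*n))).powersetCard K).filter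
      fun S => wbS n (S.map Fin.valEmbedding) < m).map
        (Finset.mapEmbedding Fin.valEmbedding).toEmbedding := by
    rw [LS, show Finset.range (2*n) = (Finset.univ : Finset (Fin (2*n))).map Fin.valEmbedding by
      ext x; simp [Fin.exists_iff], Finset.powersetCard_map, Finset.filter_map]
    rfl
  rw [this, Finset.card_map]

lemma eps_eq (n K m : ℕ) (h : K ≤ 2*n) :
    epsWB (2*n) K m = (LS n K m).card / ((2*n).choose K : ℝ) := by
  have u := unif (2*n) K h (fun S => wbS n (S.map Fin.valEmbedding) < m)
  rw [LS_eq] at u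
  unfold epsWB
  simp only [wb_eq]
  have c1 : ((2*n).choose K : ℝ) ≠ 0 := by exact_mod_cast (Nat.choose_pos h).ne'
  have c2 : (Fintype.card (Equiv.Perm (Fin (2*n))) : ℝ) ≠ 0 := by
    exact_mod_cast Fintype.card_ne_zero
  rw [div_eq_div_iff c2 c1]
  rw [mul_comm ((LS n K m).card : ℝ)]
  exact_mod_cast u

/-- Paper's Eq. (pr2): if `2 n̄_e + 1 < 2k ≤ n - 1` then
ε(2 n̄_e + 1 | [2k, 2n]) ≥ ε(2 n̄_e + 1 | [2k+2, 2n]) (for wb-pairs). -/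
theorem pr2_wb (n k ne : ℕ) (h1 : 2 * ne + 1 < 2 * k) (h2 : 2 * k ≤ n - 1) :
    epsWB (2 * n) (2 * k + 2) (2 * ne + 1) ≤ epsWB (2 * n) (2 * k) (2 * ne + 1) := by
  rw [eps_eq _ _ _ (by omega), eps_eq _ _ _ (by omega)]
  have c1 : (0:ℝ) < ((2*n).choose (2*k) : ℝ) := by exact_mod_cast Nat.choose_pos (by omega)
  have c2 : (0:ℝ) < ((2*n).choose (2*k+2) : ℝ) := by exact_mod_cast Nat.choose_pos (by omega)
  rw [div_le_div_iff₀ c2 c1]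
  exact_mod_cast dom n (2*k) (2*ne+1) (by omega)
end

section
/- Let n, k, l be nonnegative integers with l ≤ k and 2k ≤ 2n. Denote by P(2l)_{2k} the probability that a uniformly random grouping of 2n balls, exactly 2k of which are white, produces exactly 2l wb-pairs. Then P(2l)_{2k} = C(n, k−l) · C(n−(k−l), 2l) · (2k)! · (2n−2k)! · 2^{2l} / (2n)!. -/
/-- P(j)_k : the probability that a uniformly random grouping of `[k,N]` produces
exactly `j` wb-pairs. -/
noncomputable def PexactWB (N k j : ℕ) : ℝ :=
  (Finset.univ.filter fun σ : Equiv.Perm (Fin N) => wbCount N k σ = j).card /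
    (Fintype.card (Equiv.Perm (Fin N)))

open Finset in
theorem aux_fiber (N : ℕ) (f c : Fin N → Bool)
    (h : (univ.filter fun x => c x = true).card = (univ.filter fun x => f x = true).card) :
    (univ.filter fun σ : Equiv.Perm (Fin N) => ∀ x, f (σ x) = c x).card =
      Nat.factorial (univ.filter fun x => f x = true).card *
      Nat.factorial (univ.filter fun x => f x = false).card := by
  have hc : Fintype.card {x // c x = true} = Fintype.card {x // f x = true} := by
    rw [Fintype.card_subtype, Fintype.card_subtype, h]
  let e := Fintype.equivOfCardEq hc
  let s : Equiv.Perm (Fin N) := e.extendSubtype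
  have hs : ∀ x, f (s x) = c x := by
    intro x
    by_cases hx : c x = true
    · rw [hx]; exact e.extendSubtype_mem x hx
    · have := e.extendSubtype_not_mem x hx
      simp only [Bool.not_eq_true] at this hx
      rw [hx]; exact this
  have key := DomMulAct.stabilizer_card f
  rw [Fintype.prod_bool, Fintype.card_subtype, Fintype.card_subtype, Fintype.card_subtype] at key
  rw [← key]
  refine Finset.card_bij' (fun σ _ => s.symm.trans σ) (fun τ _ => s.trans τ) ?_ ?_ ?_ ?_
  · intro σ hσ
    simp only [mem_filter, mem_univ, true_and] at hσ ⊢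
    funext x
    simp only [Function.comp, Equiv.trans_apply]
    rw [hσ, ← hs, Equiv.apply_symm_apply]
  · intro τ hτ
    simp only [mem_filter, mem_univ, true_and] at hτ ⊢
    intro x
    rw [← hs]
    exact congrFun hτ (s x)
  · intro σ _; ext x; simp
  · intro σ _; ext x; simp

def auxPos (n : ℕ) : Fin (2 * n / 2) × Bool ≃ Fin (2 * n) where
  toFun p := ⟨2 * p.1.1 + p.2.toNat, by
    have := p.1.2; have := Bool.toNat_le p.2; omega⟩
  invFun x := (⟨x.1 / 2, by have := x.2; omega⟩, decide (x.1 % 2 = 1))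
  left_inv p := by
    obtain ⟨⟨i, hi⟩, b⟩ := p
    cases b
    · simp
    · simp; omega
  right_inv x := by
    ext
    by_cases h : x.1 % 2 = 1
    · simp [h]; omega
    · simp [h]; omega

open Finset in
theorem aux_white {ι : Type} [Fintype ι] [DecidableEq ι] (g : ι → Bool × Bool) :
    (univ.filter fun p : ι × Bool => (if p.2 then (g p.1).2 else (g p.1).1) = true).card =
      (univ.filter fun i => (g i).1 ≠ (g i).2).card +
      2 * (univ.filter fun i => (g i).1 = true ∧ (g i).2 = true).card := by
  simp only [card_filter]
  rw [Fintype.sum_prod_type, mul_sum, ← sum_add_distrib]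
  refine sum_congr rfl fun i _ => ?_
  rw [Fintype.sum_bool]
  generalize g i = y
  rcases y with ⟨_ | _, _ | _⟩ <;> simp

open Finset in
theorem aux_count {ι : Type} [Fintype ι] [DecidableEq ι] (a b : ℕ) :
    (univ.filter fun g : ι → Bool × Bool =>
      (univ.filter fun i => (g i).1 = true ∧ (g i).2 = true).card = a ∧
      (univ.filter fun i => (g i).1 ≠ (g i).2).card = b).card =
    (Fintype.card ι).choose a * (Fintype.card ι - a).choose b * 2 ^ b := by
  rw [card_eq_sum_card_fiberwise
    (f := fun g : ι → Bool × Bool =>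
      (⟨univ.filter fun i => (g i).1 = true ∧ (g i).2 = true,
        univ.filter fun i => (g i).1 ≠ (g i).2⟩ : (_ : Finset ι) × Finset ι))
    (t := (powersetCard a (univ : Finset ι)).sigma fun A => powersetCard b Aᶜ)]
  · rw [sum_const_nat (m := 2 ^ b)]
    · congr 1
      rw [card_sigma, sum_const_nat (m := (Fintype.card ι - a).choose b)]
      · simp
      · intro A hA
        rw [mem_powersetCard] at hA
        rw [card_powersetCard, card_compl, hA.2]
    · rintro ⟨A, B⟩ hAB
      rw [mem_sigma, mem_powersetCard, mem_powersetCard] at hAB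
      obtain ⟨⟨-, hA⟩, hB', hB⟩ := hAB
      dsimp only at hA hB hB'
      have : ∀ i, i ∈ B → i ∉ A := fun i hi => by simpa using hB' hi
      trans (Fintype.piFinset fun i => if i ∈ A then {(true, true)} else
        if i ∈ B then {(true, false), (false, true)} else
          ({(false, false)} : Finset (Bool × Bool))).card
      · congr 1
        ext g
        simp only [mem_filter, mem_univ, true_and, Fintype.mem_piFinset, Sigma.mk.injEq,
          heq_eq_eq]
        constructor
        · rintro ⟨-, rfl, rfl⟩ i
          simp only [mem_filter, mem_univ, true_and]
          rcases g i with ⟨_ | _, _ | _⟩ <;> simp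
        · intro h
          have h1 : (univ.filter fun i => (g i).1 = true ∧ (g i).2 = true) = A := by
            ext i
            have := h i
            have := this
            split_ifs at this <;> simp_all
            rcases this with h | h <;> simp [h]
          have h2 : (univ.filter fun i => (g i).1 ≠ (g i).2) = B := by
            ext i
            have hi := h i
            have := this i
            simp only [mem_filter, mem_univ, true_and]
            split_ifs at hi with u v
            · simp only [mem_singleton] at hi
              have : i ∉ B := fun w => this w u
              simp [hi, this]
            · simp only [mem_insert, mem_singleton] at hi
              rcases hi with h | h <;> simp [h, v]
            · simp only [mem_singleton] at hi
              simp [hi, v]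
          exact ⟨⟨by rw [h1, hA], by rw [h2, hB]⟩, h1, h2⟩
      · rw [Fintype.card_piFinset, ← hB, ← prod_const, ← Fintype.prod_ite_mem B (fun _ => 2)]
        refine prod_congr rfl fun i _ => ?_
        by_cases hi : i ∈ B
        · simp [hi, this i hi]
        · by_cases hi' : i ∈ A <;> simp [hi, hi']
  · intro g hg
    simp only [coe_filter, mem_univ, true_and, Set.mem_ofPred_eq] at hg
    simp only [coe_sigma, Set.mem_sigma_iff, mem_coe, mem_powersetCard]
    refine ⟨⟨subset_univ _, hg.1⟩, ?_, hg.2⟩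
    intro i
    simp only [mem_filter, mem_univ, true_and, mem_compl]
    rcases g i with ⟨_ | _, _ | _⟩ <;> simp

open Finset in
theorem aux_perm (n k l : ℕ) (hl : l ≤ k) (hk : 2 * k ≤ 2 * n) :
    (univ.filter fun σ : Equiv.Perm (Fin (2 * n)) => wbCount (2 * n) (2 * k) σ = 2 * l).card =
    n.choose (k - l) * (n - (k - l)).choose (2 * l) * 2 ^ (2 * l) *
      (Nat.factorial (2 * k) * Nat.factorial (2 * n - 2 * k)) := by
  let f : Fin (2 * n) → Bool := fun x => decide (x.1 < 2 * k)
  have hf1 : (univ.filter fun x => f x = true).card = 2 * k := by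
    simp only [f, decide_eq_true_eq]
    rw [Fin.card_filter_val_lt]; omega
  have hf0 : (univ.filter fun x => f x = false).card = 2 * n - 2 * k := by
    have h := card_filter_add_card_filter_not (s := (univ : Finset (Fin (2 * n))))
      (fun x => f x = true)
    simp only [Bool.not_eq_true, card_univ, Fintype.card_fin] at h
    omega
  let Φ : Equiv.Perm (Fin (2 * n)) → Fin (2 * n / 2) → Bool × Bool := fun σ i =>
    (f (σ (auxPos n (i, false))), f (σ (auxPos n (i, true))))
  have hwb : ∀ σ, wbCount (2 * n) (2 * k) σ =
      (univ.filter fun i => (Φ σ i).1 ≠ (Φ σ i).2).card := by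
    intro σ
    unfold wbCount
    congr 1
    ext i
    simp only [mem_filter, mem_univ, true_and, Φ, f, auxPos, Equiv.coe_fn_mk, Bool.toNat_false,
      Bool.toNat_true, add_zero, ne_eq, decide_eq_decide]
    tauto
  let C : (Fin (2 * n / 2) → Bool × Bool) → Fin (2 * n) → Bool := fun g x =>
    if ((auxPos n).symm x).2 then (g ((auxPos n).symm x).1).2 else (g ((auxPos n).symm x).1).1
  have hC : ∀ g, (univ.filter fun x => C g x = true).card =
      (univ.filter fun i => (g i).1 ≠ (g i).2).card +
      2 * (univ.filter fun i => (g i).1 = true ∧ (g i).2 = true).card := by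
    intro g
    rw [← aux_white g]
    refine card_equiv (auxPos n).symm ?_
    intro x
    simp only [mem_filter, mem_univ, true_and, C]
  have hΦ : ∀ σ g, Φ σ = g ↔ ∀ x, f (σ x) = C g x := by
    intro σ g
    constructor
    · rintro rfl x
      obtain ⟨⟨i, b⟩, rfl⟩ := (auxPos n).surjective x
      cases b <;> simp [C, Φ]
    · intro h
      funext i
      have h1 := h (auxPos n (i, false))
      have h2 := h (auxPos n (i, true))
      simp only [C, Equiv.symm_apply_apply] at h1 h2
      simp only [Φ, h1, h2]
      simp
  have hcount := aux_count (ι := Fin (2 * n / 2)) (k - l) (2 * l)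
  rw [show Fintype.card (Fin (2 * n / 2)) = n by simp] at hcount
  rw [card_eq_sum_card_fiberwise (f := Φ) (t := univ.filter fun g =>
      (univ.filter fun i => (g i).1 = true ∧ (g i).2 = true).card = k - l ∧
      (univ.filter fun i => (g i).1 ≠ (g i).2).card = 2 * l)]
  · rw [← hcount]
    apply sum_const_nat
    intro g hg
    simp only [mem_filter, mem_univ, true_and] at hg
    have := aux_fiber (2 * n) f (C g) (by rw [hC, hg.1, hg.2, hf1]; omega)
    rw [hf1, hf0] at this
    rw [← this]
    congr 1
    ext σ
    simp only [mem_filter, mem_univ, true_and]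
    rw [← hΦ, hwb]
    constructor
    · exact fun h => h.2
    · intro h
      exact ⟨by rw [h]; exact hg.2, h⟩
  · intro σ hσ
    simp only [coe_filter, mem_univ, true_and, Set.mem_ofPred_eq] at hσ ⊢
    rw [hwb] at hσ
    refine ⟨?_, hσ⟩
    have h := hC (Φ σ)
    have h2 : (univ.filter fun x => C (Φ σ) x = true).card = 2 * k := by
      rw [← hf1]
      refine card_equiv σ ?_
      intro x
      simp only [mem_filter, mem_univ, true_and]
      rw [(hΦ σ _).1 rfl x]
    omega

/-- Explicit formula: P(2l)_{2k} = C(n, k-l) C(n-(k-l), 2l) (2k)! (2n-2k)! 2^(2l) / (2n)!. -/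
theorem pexact_formula (n k l : ℕ) (hl : l ≤ k) (hk : 2 * k ≤ 2 * n) :
    PexactWB (2 * n) (2 * k) (2 * l) =
      ((n.choose (k - l) : ℝ) * ((n - (k - l)).choose (2 * l) : ℝ) *
        (Nat.factorial (2 * k) : ℝ) * (Nat.factorial (2 * n - 2 * k) : ℝ) *
        2 ^ (2 * l)) / (Nat.factorial (2 * n) : ℝ) := by
  unfold PexactWB
  rw [aux_perm n k l hl hk, Fintype.card_perm, Fintype.card_fin]
  push_cast
  ring
end

section
/- Let n, k, l be nonnegative integers with 2k+1 ≤ 2n and 2k < 2n. Denote by P(j)_{m} the probability that a uniformly random grouping of 2n balls, exactly m of which are white, produces exactly j wb-pairs. Then P(2l+1)_{2k+1} = ((2n−2k−2l)/(2n−2k)) · P(2l)_{2k} + ((2l+2)/(2n−2k)) · P(2l+2)_{2k}. (Paper's first recursion in Eq. (15).) -/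
def wbPart (p : ℕ) : ℕ := if p % 2 = 0 then p + 1 else p - 1

def wbCnt (c : ℕ → Bool) (n : ℕ) : ℕ :=
  ∑ i ∈ Finset.range n, if c (2 * i) = c (2 * i + 1) then 0 else 1

theorem wbCnt_bw (c : ℕ → Bool) (n : ℕ) :
    (∑ p ∈ Finset.range (2 * n), if c p = false ∧ c (wbPart p) = true then 1 else 0)
      = wbCnt c n := by
  unfold wbCnt
  induction n with
  | zero => simp
  | succ n ih =>
    rw [show 2 * (n + 1) = 2 * n + 1 + 1 by ring, Finset.sum_range_succ, Finset.sum_range_succ, ih,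
      Finset.sum_range_succ]
    have e1 : wbPart (2 * n) = 2 * n + 1 := by unfold wbPart; split_ifs <;> omega
    have e2 : wbPart (2 * n + 1) = 2 * n := by unfold wbPart; split_ifs <;> omega
    rw [e1, e2]
    cases c (2 * n) <;> cases c (2 * n + 1) <;> simp

theorem wbCnt_upd (c : ℕ → Bool) (n p : ℕ) (hp : p < 2 * n) (hc : c p = false) :
    (wbCnt (Function.update c p true) n : ℤ) =
      wbCnt c n + (if c (wbPart p) = true then -1 else 1) := by
  unfold wbCnt
  have hm : p / 2 ∈ Finset.range n := by rw [Finset.mem_range]; omega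
  rw [← Finset.add_sum_erase _ _ hm, ← Finset.add_sum_erase _ _ hm]
  have hE : ∀ i ∈ (Finset.range n).erase (p / 2),
      (if Function.update c p true (2 * i) = Function.update c p true (2 * i + 1) then 0 else 1)
      = (if c (2 * i) = c (2 * i + 1) then 0 else 1) := by
    intro i hi
    have hi' := (Finset.mem_erase.mp hi).1
    rw [Function.update_of_ne (by omega), Function.update_of_ne (by omega)]
  rw [Finset.sum_congr rfl hE]
  rcases Nat.even_or_odd' p with ⟨q, rfl | rfl⟩
  · have e1 : wbPart (2 * q) = 2 * q + 1 := by unfold wbPart; split_ifs <;> omega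
    have e : 2 * q / 2 = q := by omega
    rw [e1, e, Function.update_self, Function.update_of_ne (by omega), hc]
    cases c (2 * q + 1) <;> simp; ring
  · have e1 : wbPart (2 * q + 1) = 2 * q := by unfold wbPart; split_ifs <;> omega
    have e : (2 * q + 1) / 2 = q := by omega
    rw [e1, e, Function.update_self, Function.update_of_ne (by omega), hc]
    cases c (2 * q) <;> simp; ring

def wbCol (N M : ℕ) (σ : Equiv.Perm (Fin N)) (m : ℕ) : Bool :=
  if h : m < N then decide ((σ ⟨m, h⟩).1 < M) else false

theorem wbCount_eq_cnt (n M : ℕ) (σ : Equiv.Perm (Fin (2 * n))) :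
    wbCount (2 * n) M σ = wbCnt (wbCol (2 * n) M σ) n := by
  have hn : 2 * n / 2 = n := by omega
  unfold wbCount wbCnt
  rw [Finset.card_filter]
  have : Finset.range n = Finset.range (2 * n / 2) := by rw [hn]
  rw [this, Finset.sum_range]
  refine Finset.sum_congr rfl fun i _ => ?_
  have hi := i.isLt
  have a1 : 2 * i.1 < 2 * n := by omega
  have a2 : 2 * i.1 + 1 < 2 * n := by omega
  simp only [wbCol, a1, a2, dif_pos]
  by_cases h1 : (σ ⟨2 * i.1, a1⟩).1 < M <;> by_cases h2 : (σ ⟨2 * i.1 + 1, a2⟩).1 < M <;>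
    simp [h1, h2]

theorem wbCol_swap (N M : ℕ) (hM : M < N) (σ : Equiv.Perm (Fin N)) (p : Fin N)
    (hx : M ≤ (σ p).1) :
    wbCol N (M + 1) (Equiv.swap ⟨M, hM⟩ (σ p) * σ) = Function.update (wbCol N M σ) p.1 true := by
  funext m
  by_cases hm : m = p.1
  · subst hm
    simp [wbCol]
  · rw [Function.update_of_ne hm]
    unfold wbCol
    split_ifs with h
    · have hne : σ ⟨m, h⟩ ≠ σ p := by
        intro e
        exact hm (congrArg Fin.val (σ.injective e))
      rw [Equiv.Perm.mul_apply]
      by_cases h3 : σ ⟨m, h⟩ = ⟨M, hM⟩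
      · have hne' : (σ p).1 ≠ M := by
          intro e
          apply hne
          rw [h3]; exact Fin.ext e.symm
        rw [h3, Equiv.swap_apply_left]
        simp
        omega
      · rw [Equiv.swap_apply_of_ne_of_ne h3 hne]
        have : (σ ⟨m, h⟩).1 ≠ M := fun e => h3 (Fin.ext e)
        simp
        omega
    · rfl

theorem wbCol_swap_same (N M : ℕ) (hM : M < N) (σ : Equiv.Perm (Fin N)) :
    (∑ p ∈ Finset.range N, if wbCol N M σ p = false then (1 : ℤ) else 0) = N - M := by
  rw [Finset.sum_range]
  have : ∀ p : Fin N, (if wbCol N M σ p = false then (1 : ℤ) else 0) =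
      (fun x : Fin N => if x.1 < M then (0 : ℤ) else 1) (σ p) := by
    intro p
    simp [wbCol]
    split_ifs <;> first | rfl | omega
  rw [Finset.sum_congr rfl fun p _ => this p,
    Equiv.sum_comp σ (fun x : Fin N => if x.1 < M then (0 : ℤ) else 1),
    ← Finset.sum_range (fun x => if x < M then (0 : ℤ) else 1)]
  obtain ⟨d, rfl⟩ := Nat.exists_eq_add_of_le hM.le
  rw [Finset.sum_range_add]
  rw [Finset.sum_eq_zero (fun x hx => by rw [if_pos (Finset.mem_range.mp hx)])]
  simp

theorem wb_local (n M j : ℕ) (hM : M < 2 * n) (σ : Equiv.Perm (Fin (2 * n))) :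
    (∑ x : Fin (2 * n), if M ≤ x.1 ∧
        wbCount (2 * n) (M + 1) (Equiv.swap ⟨M, hM⟩ x * σ) = j + 1 then (1 : ℤ) else 0) =
    (2 * n - M - j) * (if wbCount (2 * n) M σ = j then 1 else 0) +
    (j + 2) * (if wbCount (2 * n) M σ = j + 2 then 1 else 0) := by
  rw [← Equiv.sum_comp σ]
  have hB := wbCnt_bw (wbCol (2 * n) M σ) n
  have hT := wbCol_swap_same (2 * n) M hM σ
  rw [wbCount_eq_cnt]
  set c := wbCol (2 * n) M σ with hc
  set W := wbCnt c n with hW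
  have key : ∀ p : Fin (2 * n), (if M ≤ (σ p).1 ∧
      wbCount (2 * n) (M + 1) (Equiv.swap ⟨M, hM⟩ (σ p) * σ) = j + 1 then (1 : ℤ) else 0) =
      (fun p : ℕ =>
        (if W = j then 1 else 0) * ((if c p = false then (1 : ℤ) else 0)
          - (if c p = false ∧ c (wbPart p) = true then 1 else 0)) +
        (if W = j + 2 then 1 else 0) *
          (if c p = false ∧ c (wbPart p) = true then 1 else 0)) p.1 := by
    intro p
    have hcp : c p.1 = false ↔ M ≤ (σ p).1 := by simp [hc, wbCol]
    by_cases h : M ≤ (σ p).1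
    · have h' := hcp.mpr h
      have hu := wbCnt_upd c n p.1 p.2 h'
      rw [wbCount_eq_cnt, wbCol_swap _ _ hM σ p h, ← hc]
      simp only [h, h', true_and]
      cases hq : c (wbPart p.1) <;> simp [hq] at hu ⊢ <;> congr 1 <;>
        simp only [eq_iff_iff] <;> omega
    · have h' : ¬ c p.1 = false := fun e => h (hcp.mp e)
      simp [h, h']
  rw [Finset.sum_congr rfl fun p _ => key p, ← Finset.sum_range (fun p : ℕ =>
        (if W = j then 1 else 0) * ((if c p = false then (1 : ℤ) else 0)
          - (if c p = false ∧ c (wbPart p) = true then 1 else 0)) +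
        (if W = j + 2 then 1 else 0) *
          (if c p = false ∧ c (wbPart p) = true then 1 else 0))]
  rw [Finset.sum_add_distrib, ← Finset.mul_sum, ← Finset.mul_sum, Finset.sum_sub_distrib, hT]
  have hB' : (∑ p ∈ Finset.range (2 * n),
      if c p = false ∧ c (wbPart p) = true then (1 : ℤ) else 0) = W := by
    rw [← hB]; push_cast; rfl
  rw [hB']
  split_ifs with a b b
  · omega
  · rw [a]; push_cast; ring
  · rw [b]; push_cast; ring
  · simp

theorem wbCount_swap (N M : ℕ) (hM : M < N) (j : ℕ) :
    ((N : ℤ) - M) * (∑ σ : Equiv.Perm (Fin N), if wbCount N (M + 1) σ = j then (1 : ℤ) else 0) =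
    ∑ σ : Equiv.Perm (Fin N), ∑ x : Fin N, if M ≤ x.1 ∧
        wbCount N (M + 1) (Equiv.swap ⟨M, hM⟩ x * σ) = j then (1 : ℤ) else 0 := by
  rw [Finset.sum_comm]
  have : ∀ x : Fin N, (∑ σ : Equiv.Perm (Fin N), if M ≤ x.1 ∧
        wbCount N (M + 1) (Equiv.swap ⟨M, hM⟩ x * σ) = j then (1 : ℤ) else 0) =
      (if wbCol N M 1 x.1 = false then (1 : ℤ) else 0) *
      (∑ σ : Equiv.Perm (Fin N), if wbCount N (M + 1) σ = j then (1 : ℤ) else 0) := by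
    intro x
    have hx : wbCol N M 1 x.1 = false ↔ M ≤ x.1 := by
      simp only [wbCol, x.isLt, dif_pos, decide_eq_false_iff_not, not_lt]
      rfl
    by_cases h : M ≤ x.1
    · rw [if_pos (hx.mpr h), one_mul]
      refine Fintype.sum_equiv (Equiv.mulLeft (Equiv.swap ⟨M, hM⟩ x)) _ _ fun σ => ?_
      rw [Equiv.coe_mulLeft]
      simp only [h, true_and]
    · simp [h, hx]
  rw [Finset.sum_congr rfl fun x _ => this x, ← Finset.sum_mul,
    ← Finset.sum_range (fun x => if wbCol N M 1 x = false then (1 : ℤ) else 0),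
    wbCol_swap_same N M hM]

theorem wb_count_rec (n M j : ℕ) (hM : M < 2 * n) :
    ((2 * n : ℤ) - M) *
      ((Finset.univ.filter fun σ : Equiv.Perm (Fin (2 * n)) =>
        wbCount (2 * n) (M + 1) σ = j + 1).card : ℤ) =
    (2 * n - M - j) * ((Finset.univ.filter fun σ : Equiv.Perm (Fin (2 * n)) =>
        wbCount (2 * n) M σ = j).card : ℤ) +
    (j + 2) * ((Finset.univ.filter fun σ : Equiv.Perm (Fin (2 * n)) =>
        wbCount (2 * n) M σ = j + 2).card : ℤ) := by
  have h := wbCount_swap (2 * n) M hM (j + 1)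
  rw [Finset.sum_congr rfl fun σ _ => wb_local n M j hM σ, Finset.sum_add_distrib,
    ← Finset.mul_sum, ← Finset.mul_sum] at h
  simp only [Finset.card_filter]
  push_cast at h ⊢
  exact h

/-- Paper's first recursion in Eq. (15):
P(2l+1)_{2k+1} = ((2n-2k-2l)/(2n-2k)) P(2l)_{2k} + ((2l+2)/(2n-2k)) P(2l+2)_{2k}. -/
theorem pexact_recursion_odd (n k l : ℕ) (h1 : 2 * k + 1 ≤ 2 * n) (h2 : 2 * k < 2 * n) :
    PexactWB (2 * n) (2 * k + 1) (2 * l + 1) =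
      ((2 * n - 2 * k - 2 * l : ℝ) / (2 * n - 2 * k)) * PexactWB (2 * n) (2 * k) (2 * l)
      + ((2 * l + 2 : ℝ) / (2 * n - 2 * k)) * PexactWB (2 * n) (2 * k) (2 * l + 2) := by
  have h := wb_count_rec n (2 * k) (2 * l) h2
  have hR := congrArg (fun z : ℤ => (z : ℝ)) h
  push_cast at hR
  have hne : (2 * n - 2 * k : ℝ) ≠ 0 := by
    have : (2 * k : ℝ) < 2 * n := by exact_mod_cast h2
    linarith
  unfold PexactWB
  rw [div_mul_div_comm, div_mul_div_comm, ← add_div, ← hR,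
    mul_div_mul_left _ _ hne]
end

section
/- Let n, k, l be nonnegative integers with l ≥ 1, 2k+2 ≤ 2n and 2k+1 < 2n. Denote by P(j)_{m} the probability that a uniformly random grouping of 2n balls, exactly m of which are white, produces exactly j wb-pairs. Then P(2l)_{2k+2} = ((2n−(2k+1)−(2l−1))/(2n−(2k+1))) · P(2l−1)_{2k+1} + ((2l+1)/(2n−(2k+1))) · P(2l+1)_{2k+1}. (Paper's second recursion in Eq. (15)–(16).) -/
open Classical in
noncomputable def wbc (n : ℕ) (P : ℕ → Prop) : ℕ :=
  ((Finset.range n).filter fun i => (P (2*i) ∧ ¬ P (2*i+1)) ∨ (¬ P (2*i) ∧ P (2*i+1))).card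

def ptn (q : ℕ) : ℕ := if q % 2 = 0 then q + 1 else q - 1

theorem wbc_white (n : ℕ) (P : ℕ → Prop) (q : ℕ) (hq : q < 2 * n) (hP : ¬ P q)
    (hw : P (ptn q)) : wbc n (fun j => P j ∨ j = q) + 1 = wbc n P := by
  classical
  unfold wbc
  rw [← Finset.card_insert_of_notMem (a := q / 2)]
  · congr 1
    ext i
    simp only [Finset.mem_insert, Finset.mem_filter, Finset.mem_range]
    unfold ptn at hw
    by_cases hi : i = q / 2
    · subst hi
      rcases Nat.mod_two_eq_zero_or_one q with h | h
      · have e : 2 * (q / 2) = q := by omega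
        simp [h] at hw
        simp [e, hP, hw]; omega
      · have e : 2 * (q / 2) = q - 1 := by omega
        have e' : q - 1 + 1 = q := by omega
        simp [h] at hw
        simp [e, e', hP, hw]; omega
    · have e1 : 2 * i ≠ q := by omega
      have e2 : 2 * i + 1 ≠ q := by omega
      simp [hi, e1, e2]
  · simp only [Finset.mem_filter, Finset.mem_range]
    unfold ptn at hw
    rcases Nat.mod_two_eq_zero_or_one q with h | h
    · have e : 2 * (q / 2) = q := by omega
      simp [h] at hw
      simp [e, hw]
    · have e : 2 * (q / 2) = q - 1 := by omega
      have e' : q - 1 + 1 = q := by omega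
      simp [h] at hw
      simp [e, e', hw]

theorem wbc_black (n : ℕ) (P : ℕ → Prop) (q : ℕ) (hq : q < 2 * n) (hP : ¬ P q)
    (hw : ¬ P (ptn q)) : wbc n (fun j => P j ∨ j = q) = wbc n P + 1 := by
  classical
  unfold wbc
  rw [← Finset.card_insert_of_notMem (a := q / 2)]
  · congr 1
    ext i
    simp only [Finset.mem_insert, Finset.mem_filter, Finset.mem_range]
    unfold ptn at hw
    by_cases hi : i = q / 2
    · subst hi
      rcases Nat.mod_two_eq_zero_or_one q with h | h
      · have e : 2 * (q / 2) = q := by omega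
        simp [h] at hw
        simp [e, hP, hw]; omega
      · have e : 2 * (q / 2) = q - 1 := by omega
        have e' : q - 1 + 1 = q := by omega
        have e'' : q - 1 ≠ q := by omega
        simp [h] at hw
        simp [e, e', e'', hP, hw]; omega
    · have e1 : 2 * i ≠ q := by omega
      have e2 : 2 * i + 1 ≠ q := by omega
      simp [hi, e1, e2]
  · simp only [Finset.mem_filter, Finset.mem_range]
    unfold ptn at hw
    rcases Nat.mod_two_eq_zero_or_one q with h | h
    · have e : 2 * (q / 2) = q := by omega
      simp [h] at hw
      simp [e, hP, hw]
    · have e : 2 * (q / 2) = q - 1 := by omega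
      have e' : q - 1 + 1 = q := by omega
      simp [h] at hw
      simp [e, e', hP, hw]

open Classical in
theorem card_wb (n : ℕ) (P : ℕ → Prop) :
    ((Finset.range (2 * n)).filter fun q => ¬ P q ∧ P (ptn q)).card = wbc n P := by
  unfold wbc
  have hodd : ∀ i, (2 * i + 1) % 2 = 1 := by intro i; omega
  refine Finset.card_bij' (fun q _ => q / 2) (fun i _ => if P (2 * i) then 2 * i + 1 else 2 * i)
    ?_ ?_ ?_ ?_
  · intro q hq
    have hq' := Finset.mem_filter.1 hq
    rw [Finset.mem_range] at hq'
    simp only [Finset.mem_filter, Finset.mem_range]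
    unfold ptn at hq'
    obtain ⟨h0, h1, h2⟩ := hq'
    refine ⟨by omega, ?_⟩
    rcases Nat.mod_two_eq_zero_or_one q with h | h
    · have e : 2 * (q / 2) = q := by omega
      simp [h] at h2
      simp [e, h1, h2]
    · have e : 2 * (q / 2) = q - 1 := by omega
      have e' : q - 1 + 1 = q := by omega
      simp [h] at h2
      simp [e, e', h1, h2]
  · intro i hi
    have hi' := Finset.mem_filter.1 hi
    rw [Finset.mem_range] at hi'
    obtain ⟨h0, h1⟩ := hi'
    simp only [Finset.mem_filter, Finset.mem_range]
    by_cases h : P (2 * i)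
    · have h3 : ¬ P (2 * i + 1) := by tauto
      rw [if_pos h]
      refine ⟨by omega, h3, ?_⟩
      simp [ptn, hodd, h]
    · have h3 : P (2 * i + 1) := by tauto
      rw [if_neg h]
      refine ⟨by omega, h, ?_⟩
      simp [ptn, h3]
  · intro q hq
    have hq' := Finset.mem_filter.1 hq
    rw [Finset.mem_range] at hq'
    unfold ptn at hq'
    obtain ⟨h0, h1, h2⟩ := hq'
    rcases Nat.mod_two_eq_zero_or_one q with h | h
    · have e : 2 * (q / 2) = q := by omega
      simp [e, h1]
    · have e : 2 * (q / 2) = q - 1 := by omega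
      simp [h] at h2
      simp [e, h2]; omega
  · intro i hi
    split_ifs <;> omega

open Classical in
theorem card_flip (n : ℕ) (P : ℕ → Prop) (l : ℕ) (hl : 1 ≤ l) :
    ((((Finset.range (2 * n)).filter fun q => ¬ P q ∧
      wbc n (fun j => P j ∨ j = q) = 2 * l).card : ℕ) : ℝ) =
    (if wbc n P = 2 * l - 1 then
      ((((Finset.range (2 * n)).filter fun q => ¬ P q).card : ℕ) : ℝ) - (2 * l - 1) else 0)
    + (if wbc n P = 2 * l + 1 then (2 * l + 1 : ℝ) else 0) := by
  have key : ((Finset.range (2 * n)).filter fun q => ¬ P q).card =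
      wbc n P + ((Finset.range (2 * n)).filter fun q => ¬ P q ∧ ¬ P (ptn q)).card := by
    rw [← card_wb, ← Finset.card_filter_add_card_filter_not (fun q => P (ptn q)),
      Finset.filter_filter, Finset.filter_filter]
  by_cases ha : wbc n P = 2 * l - 1
  · have hb : wbc n P ≠ 2 * l + 1 := by omega
    rw [if_pos ha, if_neg hb, key, ha]
    have : ((Finset.range (2 * n)).filter fun q => ¬ P q ∧
      wbc n (fun j => P j ∨ j = q) = 2 * l) =
      ((Finset.range (2 * n)).filter fun q => ¬ P q ∧ ¬ P (ptn q)) := by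
      apply Finset.filter_congr
      intro q hq
      rw [Finset.mem_range] at hq
      by_cases h1 : P q
      · simp [h1]
      by_cases h2 : P (ptn q)
      · have := wbc_white n P q hq h1 h2
        simp only [h1, h2]; simp; omega
      · have := wbc_black n P q hq h1 h2
        simp only [h1, h2]; simp; omega
    rw [this]
    push_cast [Nat.cast_sub (show 1 ≤ 2 * l by omega)]
    ring
  · rw [if_neg ha]
    by_cases hb : wbc n P = 2 * l + 1
    · rw [if_pos hb]
      have : ((Finset.range (2 * n)).filter fun q => ¬ P q ∧
        wbc n (fun j => P j ∨ j = q) = 2 * l) =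
        ((Finset.range (2 * n)).filter fun q => ¬ P q ∧ P (ptn q)) := by
        apply Finset.filter_congr
        intro q hq
        rw [Finset.mem_range] at hq
        by_cases h1 : P q
        · simp [h1]
        by_cases h2 : P (ptn q)
        · have := wbc_white n P q hq h1 h2
          simp only [h1, h2]; simp; omega
        · have := wbc_black n P q hq h1 h2
          simp only [h1, h2]; simp; omega
      rw [this, card_wb, hb]; push_cast; ring
    · rw [if_neg hb, Finset.filter_eq_empty_iff.2]
      · simp
      · rintro q hq ⟨h1, h3⟩
        rw [Finset.mem_range] at hq
        by_cases h2 : P (ptn q)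
        · have := wbc_white n P q hq h1 h2
          omega
        · have := wbc_black n P q hq h1 h2
          omega

theorem wbCount_eq (n m : ℕ) (σ : Equiv.Perm (Fin (2 * n))) (P : ℕ → Prop)
    (hP : ∀ j : Fin (2 * n), P j.1 ↔ (σ j).1 < m) : wbCount (2 * n) m σ = wbc n P := by
  classical
  unfold wbCount wbc
  refine Finset.card_bij (fun i _ => i.1) ?_ ?_ ?_
  · intro i hi
    simp only [Finset.mem_filter, Finset.mem_range, Finset.mem_univ, true_and, ← hP] at hi ⊢
    exact ⟨by have := i.2; omega, hi⟩
  · intro a _ b _ h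
    exact Fin.ext h
  · intro i hi
    simp only [Finset.mem_filter, Finset.mem_range] at hi
    refine ⟨⟨i, by omega⟩, ?_, rfl⟩
    simp only [Finset.mem_filter, Finset.mem_univ, true_and, ← hP]
    exact hi.2

theorem card_B (n m : ℕ) (hm : m < 2 * n) :
    (Finset.univ.filter fun b : Fin (2 * n) => m ≤ b.1).card = 2 * n - m := by
  have := Fin.card_Ici (⟨m, hm⟩ : Fin (2 * n))
  rw [← this]
  congr 1
  ext b
  simp [Fin.le_def]

theorem flip_sigma (n m l : ℕ) (hl : 1 ≤ l) (hm : m < 2 * n) (σ : Equiv.Perm (Fin (2 * n))) :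
    ((((Finset.univ.filter fun b : Fin (2 * n) => m ≤ b.1).filter fun b =>
      wbCount (2 * n) (m + 1) (Equiv.swap ⟨m, hm⟩ b * σ) = 2 * l).card : ℕ) : ℝ) =
    (if wbCount (2 * n) m σ = 2 * l - 1 then (2 * n - m : ℝ) - (2 * l - 1) else 0)
    + (if wbCount (2 * n) m σ = 2 * l + 1 then (2 * l + 1 : ℝ) else 0) := by
  classical
  obtain ⟨P, hP⟩ : ∃ P : ℕ → Prop, ∀ j : Fin (2 * n), P j.1 ↔ (σ j).1 < m :=
    ⟨fun j => ∃ h : j < 2 * n, (σ ⟨j, h⟩).1 < m, fun j => by simp⟩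
  have h0 := wbCount_eq n m σ P hP
  have h1 : ((Finset.range (2 * n)).filter fun q => ¬ P q).card = 2 * n - m := by
    rw [← card_B n m hm]
    symm
    refine Finset.card_bij (fun b _ => (σ.symm b).1) ?_ ?_ ?_
    · intro b hb
      simp only [Finset.mem_filter, Finset.mem_range, Finset.mem_univ, true_and] at hb ⊢
      rw [hP]; simp [hb]
    · intro a _ b _ h
      exact σ.symm.injective (Fin.ext h)
    · intro q hq
      simp only [Finset.mem_filter, Finset.mem_range] at hq
      refine ⟨σ ⟨q, hq.1⟩, ?_, by simp⟩
      have := hP ⟨q, hq.1⟩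
      simp only [Finset.mem_filter, Finset.mem_univ, true_and]
      have h3 := hq.2
      simp only at this
      rw [this] at h3
      omega
  have hsw : ∀ b : Fin (2 * n), m ≤ b.1 → wbCount (2 * n) (m + 1) (Equiv.swap ⟨m, hm⟩ b * σ) =
      wbc n (fun j => P j ∨ j = (σ.symm b).1) := by
    intro b hb
    apply wbCount_eq
    intro j
    rw [hP, ← Fin.ext_iff, Equiv.eq_symm_apply, Equiv.Perm.mul_apply, Equiv.swap_apply_def]
    split_ifs with e1 e2
    · rw [e1]; simp [Fin.ext_iff]; omega
    · rw [e2]; simp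
    · rw [Fin.ext_iff] at *; simp at *; omega
  have h2 : ((Finset.univ.filter fun b : Fin (2 * n) => m ≤ b.1).filter fun b =>
      wbCount (2 * n) (m + 1) (Equiv.swap ⟨m, hm⟩ b * σ) = 2 * l).card =
      ((Finset.range (2 * n)).filter fun q => ¬ P q ∧
      wbc n (fun j => P j ∨ j = q) = 2 * l).card := by
    refine Finset.card_bij (fun b _ => (σ.symm b).1) ?_ ?_ ?_
    · intro b hb
      simp only [Finset.mem_filter, Finset.mem_range, Finset.mem_univ, true_and] at hb ⊢
      rw [hP, ← hsw b hb.1]; simp [hb]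
    · intro a _ b _ h
      exact σ.symm.injective (Fin.ext h)
    · intro q hq
      simp only [Finset.mem_filter, Finset.mem_range] at hq
      have := hP ⟨q, hq.1⟩
      have h3 := hq.2.1
      simp only at this
      rw [this] at h3
      refine ⟨σ ⟨q, hq.1⟩, ?_, by simp⟩
      simp only [Finset.mem_filter, Finset.mem_univ, true_and]
      refine ⟨by omega, ?_⟩
      rw [hsw _ (by omega)]
      simpa using hq.2.2
  rw [h2, card_flip n P l hl, h1, h0, Nat.cast_sub hm.le]
  push_cast
  rfl

theorem count_rec (n m l : ℕ) (hl : 1 ≤ l) (hm : m < 2 * n) :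
    (2 * n - m : ℝ) * ((Finset.univ.filter fun σ : Equiv.Perm (Fin (2 * n)) =>
      wbCount (2 * n) (m + 1) σ = 2 * l).card : ℝ) =
    ((2 * n - m : ℝ) - (2 * l - 1)) * ((Finset.univ.filter fun σ : Equiv.Perm (Fin (2 * n)) =>
      wbCount (2 * n) m σ = 2 * l - 1).card : ℝ)
    + (2 * l + 1 : ℝ) * ((Finset.univ.filter fun σ : Equiv.Perm (Fin (2 * n)) =>
      wbCount (2 * n) m σ = 2 * l + 1).card : ℝ) := by
  have hs := Finset.sum_congr (rfl : (Finset.univ : Finset (Equiv.Perm (Fin (2 * n)))) = _)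
    (fun σ _ => flip_sigma n m l hl hm σ)
  rw [Finset.sum_add_distrib, ← Finset.sum_filter, ← Finset.sum_filter, Finset.sum_const,
    Finset.sum_const, nsmul_eq_mul, nsmul_eq_mul] at hs
  rw [mul_comm ((2 * n - m : ℝ) - (2 * l - 1)), mul_comm (2 * l + 1 : ℝ), ← hs]
  simp_rw [Finset.card_filter _ (Finset.filter _ _)]
  push_cast
  rw [Finset.sum_comm]
  have : ∀ b ∈ (Finset.univ.filter fun b : Fin (2 * n) => m ≤ b.1),
      (∑ σ : Equiv.Perm (Fin (2 * n)),
        if wbCount (2 * n) (m + 1) (Equiv.swap ⟨m, hm⟩ b * σ) = 2 * l then (1 : ℝ) else 0) =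
      ((Finset.univ.filter fun σ : Equiv.Perm (Fin (2 * n)) =>
      wbCount (2 * n) (m + 1) σ = 2 * l).card : ℝ) := by
    intro b _
    rw [Finset.card_filter]
    push_cast
    exact Equiv.sum_comp (Equiv.mulLeft (Equiv.swap (⟨m, hm⟩ : Fin (2 * n)) b))
      (fun σ => if wbCount (2 * n) (m + 1) σ = 2 * l then (1 : ℝ) else 0)
  rw [Finset.sum_congr rfl this, Finset.sum_const, card_B n m hm, nsmul_eq_mul,
    Nat.cast_sub hm.le]
  push_cast
  rfl

/-- Paper's second recursion in Eqs. (15)-(16): for l ≥ 1,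
P(2l)_{2k+2} = ((2n-(2k+1)-(2l-1))/(2n-(2k+1))) P(2l-1)_{2k+1}
             + ((2l+1)/(2n-(2k+1))) P(2l+1)_{2k+1}. -/
theorem pexact_recursion_even (n k l : ℕ) (hl : 1 ≤ l)
    (h1 : 2 * k + 2 ≤ 2 * n) (h2 : 2 * k + 1 < 2 * n) :
    PexactWB (2 * n) (2 * k + 2) (2 * l) =
      ((2 * n - (2 * k + 1) - (2 * l - 1) : ℝ) / (2 * n - (2 * k + 1))) *
        PexactWB (2 * n) (2 * k + 1) (2 * l - 1)
      + ((2 * l + 1 : ℝ) / (2 * n - (2 * k + 1))) *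
        PexactWB (2 * n) (2 * k + 1) (2 * l + 1) := by
  have h := count_rec n (2 * k + 1) l hl h2
  have hpos : (2 * n - (2 * k + 1) : ℝ) ≠ 0 := by
    have : ((2 * k + 1 : ℕ) : ℝ) < ((2 * n : ℕ) : ℝ) := by exact_mod_cast h2
    push_cast at this
    linarith
  unfold PexactWB
  push_cast at h
  rw [div_mul_div_comm, div_mul_div_comm, ← add_div, ← h, mul_div_mul_left _ _ hpos]
end

section
/- Let n, k, n̄_e be nonnegative integers with 2 n̄_e + 1 < 2k ≤ n − 1. Define x1 = ((2n − 2k − 2 n̄_e)/(2n − 2k)) · P(2 n̄_e)_{2k} and x2 = ((2 n̄_e + 1)/(2n − (2k+1))) · P(2 n̄_e + 1)_{2k+1}, where P(j)_{m} is the probability that a uniformly random grouping of 2n balls with exactly m white balls produces exactly j wb-pairs. Then ε(2 n̄_e + 1 | [2k+1, 2n]) = ε(2 n̄_e + 1 | [2k, 2n]) − x1, ε(2 n̄_e + 1 | [2k+2, 2n]) = ε(2 n̄_e + 1 | [2k, 2n]) − x1 + x2, and if x2 > 0 then x1/x2 = 2n/(2k+1) − 1 ≥ 1. -/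
/-- partner position -/
def pp (n : ℕ) (i : Fin (2 * n)) : Fin (2 * n) :=
  ⟨if i.1 % 2 = 0 then i.1 + 1 else i.1 - 1, by have := i.isLt; split_ifs <;> omega⟩

lemma pp_pp (n : ℕ) (i : Fin (2 * n)) : pp n (pp n i) = i := by
  apply Fin.ext
  simp only [pp]
  split_ifs <;> omega

lemma pp_ne (n : ℕ) (i : Fin (2 * n)) : pp n i ≠ i := by
  intro h
  have := congrArg Fin.val h
  simp only [pp] at this
  split_ifs at this <;> omega

/-- partner ball -/
def qq (n : ℕ) (σ : Equiv.Perm (Fin (2 * n))) (b : Fin (2 * n)) : Fin (2 * n) :=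
  σ (pp n (σ.symm b))

lemma qq_qq (n : ℕ) (σ : Equiv.Perm (Fin (2 * n))) (b : Fin (2 * n)) :
    qq n σ (qq n σ b) = b := by
  simp [qq, pp_pp]

lemma qq_ne (n : ℕ) (σ : Equiv.Perm (Fin (2 * n))) (b : Fin (2 * n)) : qq n σ b ≠ b := by
  intro h
  apply pp_ne n (σ.symm b)
  apply σ.injective
  simpa [qq] using h

lemma wb_pos (n m : ℕ) (σ : Equiv.Perm (Fin (2 * n))) :
    (Finset.univ.filter fun x : Fin (2 * n) => (σ x).1 < m ∧ ¬ (σ (pp n x)).1 < m).card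
      = wbCount (2 * n) m σ := by
  unfold wbCount
  have hp : ∀ (a : ℕ) (h : 2 * a < 2 * n) (h' : 2 * a + 1 < 2 * n),
      pp n ⟨2 * a, h⟩ = ⟨2 * a + 1, h'⟩ := by
    intro a h h'
    apply Fin.ext
    simp [pp]
  have hp' : ∀ (a : ℕ) (h : 2 * a < 2 * n) (h' : 2 * a + 1 < 2 * n),
      pp n ⟨2 * a + 1, h'⟩ = ⟨2 * a, h⟩ := by
    intro a h h'
    rw [← hp a h h', pp_pp]
  apply Finset.card_bij (fun x _ => (⟨x.1 / 2, by have := x.isLt; omega⟩ : Fin (2 * n / 2)))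
  · rintro ⟨x, hx⟩ h
    simp only [Finset.mem_filter, Finset.mem_univ, true_and] at h ⊢
    rcases Nat.even_or_odd' x with ⟨a, rfl | rfl⟩
    · have e : 2 * a / 2 = a := by omega
      rw [hp a hx (by omega)] at h
      simp only [e]
      exact Or.inl h
    · have e : (2 * a + 1) / 2 = a := by omega
      rw [hp' a (by omega) hx] at h
      simp only [e]
      exact Or.inr ⟨h.2, h.1⟩
  · rintro ⟨x, hx⟩ h ⟨y, hy⟩ h' hxy
    simp only [Finset.mem_filter, Finset.mem_univ, true_and, Fin.mk.injEq] at h h' hxy ⊢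
    rcases Nat.even_or_odd' x with ⟨a, rfl | rfl⟩ <;>
    rcases Nat.even_or_odd' y with ⟨b, rfl | rfl⟩
    · omega
    · obtain rfl : a = b := by omega
      rw [hp' a (by omega) hy] at h'
      exact absurd h.1 h'.2
    · obtain rfl : a = b := by omega
      rw [hp' a (by omega) hx] at h
      exact absurd h'.1 h.2
    · omega
  · rintro ⟨i, hi⟩ h
    simp only [Finset.mem_filter, Finset.mem_univ, true_and] at h
    rcases h with h | h
    · refine ⟨⟨2 * i, by omega⟩, ?_, ?_⟩
      · simp only [Finset.mem_filter, Finset.mem_univ, true_and]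
        rw [hp i _ (by omega)]
        exact h
      · apply Fin.ext
        simp
    · refine ⟨⟨2 * i + 1, by omega⟩, ?_, ?_⟩
      · simp only [Finset.mem_filter, Finset.mem_univ, true_and]
        rw [hp' i (by omega)]
        exact ⟨h.2, h.1⟩
      · apply Fin.ext
        simp only
        omega

lemma wb_white (n m : ℕ) (σ : Equiv.Perm (Fin (2 * n))) :
    (Finset.univ.filter fun b : Fin (2 * n) => b.1 < m ∧ ¬ (qq n σ b).1 < m).card
      = wbCount (2 * n) m σ := by
  rw [← wb_pos]
  symm
  apply Finset.card_bij (fun x _ => σ x)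
  · intro a h
    simpa [qq] using h
  · intro a _ b _ h
    exact σ.injective h
  · intro b h
    refine ⟨σ.symm b, ?_, by simp⟩
    simpa [qq] using h

lemma wb_black (n m : ℕ) (σ : Equiv.Perm (Fin (2 * n))) :
    (Finset.univ.filter fun b : Fin (2 * n) => ¬ b.1 < m ∧ (qq n σ b).1 < m).card
      = wbCount (2 * n) m σ := by
  rw [← wb_white]
  apply Finset.card_bij (fun x _ => qq n σ x)
  · intro a h
    simp only [Finset.mem_filter, Finset.mem_univ, true_and, qq_qq] at h ⊢
    exact ⟨h.2, h.1⟩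
  · intro a _ b _ h
    simpa [qq_qq] using congrArg (qq n σ) h
  · intro b h
    refine ⟨qq n σ b, ?_, by simp [qq_qq]⟩
    simp only [Finset.mem_filter, Finset.mem_univ, true_and, qq_qq] at h ⊢
    exact ⟨h.2, h.1⟩

lemma step_white (n m : ℕ) (hm : m < 2 * n) (σ : Equiv.Perm (Fin (2 * n)))
    (h : (qq n σ ⟨m, hm⟩).1 < m) :
    wbCount (2 * n) m σ = wbCount (2 * n) (m + 1) σ + 1 := by
  rw [← wb_white, ← wb_white]
  rw [← Finset.card_insert_of_notMem (a := qq n σ ⟨m, hm⟩) (by simp [qq_qq])]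
  congr 1
  ext b
  simp only [Finset.mem_filter, Finset.mem_univ, true_and, Finset.mem_insert]
  by_cases hb : b = qq n σ ⟨m, hm⟩
  · subst hb
    simp [qq_qq, h]
  · have h3 : (qq n σ b).1 ≠ m := by
      intro h4
      apply hb
      have : qq n σ b = ⟨m, hm⟩ := Fin.ext h4
      rw [← this, qq_qq]
    have h5 : b.1 = m → (qq n σ b).1 < m := by
      intro h6
      have : b = ⟨m, hm⟩ := Fin.ext h6
      rw [this]; exact h
    simp only [hb, false_or]
    omega

lemma step_black (n m : ℕ) (hm : m < 2 * n) (σ : Equiv.Perm (Fin (2 * n)))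
    (h : ¬ (qq n σ ⟨m, hm⟩).1 < m) :
    wbCount (2 * n) (m + 1) σ = wbCount (2 * n) m σ + 1 := by
  rw [← wb_white, ← wb_white]
  rw [← Finset.card_insert_of_notMem (a := (⟨m, hm⟩ : Fin (2 * n))) (by simp)]
  congr 1
  ext b
  have hne : (qq n σ ⟨m, hm⟩).1 ≠ m := fun h4 => qq_ne n σ ⟨m, hm⟩ (Fin.ext h4)
  simp only [Finset.mem_filter, Finset.mem_univ, true_and, Finset.mem_insert]
  by_cases hb : b = ⟨m, hm⟩
  · subst hb
    simp only [true_or, iff_true]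
    omega
  · have hb' : b.1 ≠ m := fun h4 => hb (Fin.ext h4)
    have h3 : b.1 < m → (qq n σ b).1 ≠ m := by
      intro hlt h4
      have : qq n σ b = ⟨m, hm⟩ := Fin.ext h4
      rw [← this, qq_qq] at h
      exact h hlt
    simp only [hb, false_or]
    omega

lemma wb_parity (n m : ℕ) (hm : m ≤ 2 * n) (σ : Equiv.Perm (Fin (2 * n))) :
    wbCount (2 * n) m σ % 2 = m % 2 := by
  induction m with
  | zero => simp [wbCount]
  | succ m ih =>
    have := ih (by omega)
    by_cases h : (qq n σ ⟨m, hm⟩).1 < m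
    · have := step_white n m hm σ h
      omega
    · have := step_black n m hm σ h
      omega

lemma swap_color (N m : ℕ) (b b' x : Fin N) (h : b.1 < m ↔ b'.1 < m) :
    (Equiv.swap b b' x).1 < m ↔ x.1 < m := by
  rw [Equiv.swap_apply_def]
  split_ifs with h1 h2
  · rw [h1]; exact h.symm
  · rw [h2]; exact h
  · rfl

lemma sym_card (n m j : ℕ) (b b' : Fin (2 * n)) (h : b.1 < m ↔ b'.1 < m)
    (C : Prop → Prop) [DecidablePred C] :
    (Finset.univ.filter fun σ : Equiv.Perm (Fin (2 * n)) =>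
      wbCount (2 * n) m σ = j ∧ C ((qq n σ b).1 < m)).card =
    (Finset.univ.filter fun σ : Equiv.Perm (Fin (2 * n)) =>
      wbCount (2 * n) m σ = j ∧ C ((qq n σ b').1 < m)).card := by
  have key : ∀ σ : Equiv.Perm (Fin (2 * n)),
      wbCount (2 * n) m (Equiv.swap b b' * σ) = wbCount (2 * n) m σ := by
    intro σ
    unfold wbCount
    simp only [Equiv.Perm.mul_apply, swap_color _ m b b' _ h]
  have key2 : ∀ σ : Equiv.Perm (Fin (2 * n)),
      ((qq n (Equiv.swap b b' * σ) b').1 < m) = ((qq n σ b).1 < m) := by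
    intro σ
    have : qq n (Equiv.swap b b' * σ) b' = Equiv.swap b b' (qq n σ b) := by
      have e : (Equiv.swap b b' * σ).symm b' = σ.symm b := by
        rw [Equiv.symm_apply_eq]
        simp
      simp only [qq, e, Equiv.Perm.mul_apply]
    rw [this]
    exact propext (swap_color _ m b b' _ h)
  apply Finset.card_bij (fun σ _ => Equiv.swap b b' * σ)
  · intro σ hs
    simp only [Finset.mem_filter, Finset.mem_univ, true_and, key, key2] at hs ⊢
    exact hs
  · intro a _ c _ hac
    exact mul_left_cancel hac
  · intro σ hs
    refine ⟨Equiv.swap b b' * σ, ?_, by rw [← mul_assoc]; simp⟩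
    simp only [Finset.mem_filter, Finset.mem_univ, true_and] at hs ⊢
    rw [key, ← key2, ← mul_assoc]
    simpa using hs

lemma double_count (n j : ℕ) (m : ℕ) (S : Finset (Fin (2 * n))) (b0 : Fin (2 * n))
    (C : Prop → Prop) [DecidablePred C]
    (hS : ∀ b ∈ S, (b.1 < m ↔ b0.1 < m))
    (hc : ∀ σ : Equiv.Perm (Fin (2 * n)),
      (S.filter fun b => C ((qq n σ b).1 < m)).card = wbCount (2 * n) m σ) :
    S.card * (Finset.univ.filter fun σ : Equiv.Perm (Fin (2 * n)) =>
      wbCount (2 * n) m σ = j ∧ C ((qq n σ b0).1 < m)).card =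
    j * (Finset.univ.filter fun σ : Equiv.Perm (Fin (2 * n)) => wbCount (2 * n) m σ = j).card := by
  have h1 : S.card * (Finset.univ.filter fun σ : Equiv.Perm (Fin (2 * n)) =>
      wbCount (2 * n) m σ = j ∧ C ((qq n σ b0).1 < m)).card =
      ∑ b ∈ S, (((Finset.univ.filter fun σ : Equiv.Perm (Fin (2 * n)) =>
        wbCount (2 * n) m σ = j)).filter fun σ => C ((qq n σ b).1 < m)).card := by
    rw [← smul_eq_mul, ← Finset.sum_const]
    apply Finset.sum_congr rfl
    intro b hb
    rw [Finset.filter_filter]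
    exact (sym_card n m j b b0 (hS b hb) C).symm
  rw [h1]
  have h2 := Finset.sum_card_bipartiteAbove_eq_sum_card_bipartiteBelow (s := S)
    (t := Finset.univ.filter fun σ : Equiv.Perm (Fin (2 * n)) => wbCount (2 * n) m σ = j)
    (fun b σ => C ((qq n σ b).1 < m))
  unfold Finset.bipartiteAbove Finset.bipartiteBelow at h2
  rw [h2, mul_comm j]
  refine Eq.trans ?_ (Finset.sum_const_nat (m := j) (f := fun _ => j) (fun _ _ => rfl))
  apply Finset.sum_congr rfl
  intro σ hs
  rw [hc]
  simpa using hs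

lemma card_lt (N m : ℕ) (hm : m ≤ N) :
    (Finset.univ.filter fun b : Fin N => b.1 < m).card = m := by
  rw [Fin.card_filter_val_lt]
  omega

lemma card_ge (N m : ℕ) (hm : m ≤ N) :
    (Finset.univ.filter fun b : Fin N => ¬ b.1 < m).card = N - m := by
  have := Finset.card_filter_add_card_filter_not (s := (Finset.univ : Finset (Fin N)))
    (fun b : Fin N => b.1 < m)
  rw [card_lt N m hm] at this
  simp only [Finset.card_univ, Fintype.card_fin] at this
  omega

lemma dc_black (n m j : ℕ) (hm : m ≤ 2 * n) (b0 : Fin (2 * n)) (hb : ¬ b0.1 < m) :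
    (2 * n - m) * (Finset.univ.filter fun σ : Equiv.Perm (Fin (2 * n)) =>
      wbCount (2 * n) m σ = j ∧ (qq n σ b0).1 < m).card =
    j * (Finset.univ.filter fun σ : Equiv.Perm (Fin (2 * n)) => wbCount (2 * n) m σ = j).card := by
  classical
  rw [← card_ge (2 * n) m hm]
  have := double_count n j m (Finset.univ.filter fun b : Fin (2 * n) => ¬ b.1 < m) b0 (fun p => p)
    (by intro b h; simp only [Finset.mem_filter, Finset.mem_univ, true_and] at h; tauto)
    (by intro σ; rw [Finset.filter_filter, ← wb_black]; congr!)
  convert this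

lemma dc_white (n m j : ℕ) (hm : m ≤ 2 * n) (b0 : Fin (2 * n)) (hb : b0.1 < m) :
    m * (Finset.univ.filter fun σ : Equiv.Perm (Fin (2 * n)) =>
      wbCount (2 * n) m σ = j ∧ ¬ (qq n σ b0).1 < m).card =
    j * (Finset.univ.filter fun σ : Equiv.Perm (Fin (2 * n)) => wbCount (2 * n) m σ = j).card := by
  classical
  have := double_count n j m (Finset.univ.filter fun b : Fin (2 * n) => b.1 < m) b0 (fun p => ¬ p)
    (by intro b h; simp only [Finset.mem_filter, Finset.mem_univ, true_and] at h; tauto)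
    (by intro σ; rw [Finset.filter_filter, ← wb_white]; congr!)
  rw [card_lt (2 * n) m hm] at this
  convert this

/-- Combination of the recursions: with
x1 = ((2n-2k-2n̄_e)/(2n-2k)) P(2n̄_e)_{2k} and
x2 = ((2n̄_e+1)/(2n-(2k+1))) P(2n̄_e+1)_{2k+1}, one has
ε(2n̄_e+1 | [2k+1,2n]) = ε(2n̄_e+1 | [2k,2n]) - x1,
ε(2n̄_e+1 | [2k+2,2n]) = ε(2n̄_e+1 | [2k,2n]) - x1 + x2, and if x2 > 0 then
x1/x2 = 2n/(2k+1) - 1 ≥ 1. -/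
theorem eps_wb_difference (n k ne : ℕ) (h1 : 2 * ne + 1 < 2 * k) (h2 : 2 * k ≤ n - 1)
    (x1 x2 : ℝ)
    (hx1 : x1 = ((2 * n - 2 * k - 2 * ne : ℝ) / (2 * n - 2 * k)) *
      PexactWB (2 * n) (2 * k) (2 * ne))
    (hx2 : x2 = ((2 * ne + 1 : ℝ) / (2 * n - (2 * k + 1))) *
      PexactWB (2 * n) (2 * k + 1) (2 * ne + 1)) :
    epsWB (2 * n) (2 * k + 1) (2 * ne + 1) = epsWB (2 * n) (2 * k) (2 * ne + 1) - x1 ∧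
    epsWB (2 * n) (2 * k + 2) (2 * ne + 1)
      = epsWB (2 * n) (2 * k) (2 * ne + 1) - x1 + x2 ∧
    (0 < x2 → x1 / x2 = 2 * n / (2 * k + 1) - 1 ∧ (1 : ℝ) ≤ 2 * n / (2 * k + 1) - 1) := by
  classical
  have hm0 : 2 * k < 2 * n := by omega
  have hm1 : 2 * k + 1 < 2 * n := by omega
  have d1 := dc_black n (2 * k) (2 * ne) hm0.le ⟨2 * k, hm0⟩ (by simp)
  have d2 := dc_black n (2 * k + 1) (2 * ne + 1) hm1.le ⟨2 * k + 1, hm1⟩ (by simp)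
  have d3 := dc_white n (2 * k + 1) (2 * ne + 1) hm1.le ⟨2 * k, hm0⟩ (by simp)
  have eA := Finset.card_filter_add_card_filter_not
    (s := Finset.univ.filter fun σ : Equiv.Perm (Fin (2 * n)) =>
      wbCount (2 * n) (2 * k) σ = 2 * ne) (fun σ => (qq n σ ⟨2 * k, hm0⟩).1 < 2 * k)
  rw [Finset.filter_filter, Finset.filter_filter] at eA
  have e13 : (Finset.univ.filter fun σ : Equiv.Perm (Fin (2 * n)) =>
      wbCount (2 * n) (2 * k + 1) σ = 2 * ne + 1 ∧ ¬ (qq n σ ⟨2 * k, hm0⟩).1 < 2 * k + 1) =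
      (Finset.univ.filter fun σ : Equiv.Perm (Fin (2 * n)) =>
      wbCount (2 * n) (2 * k) σ = 2 * ne ∧ ¬ (qq n σ ⟨2 * k, hm0⟩).1 < 2 * k) := by
    ext σ
    simp only [Finset.mem_filter, Finset.mem_univ, true_and]
    have hne : (qq n σ ⟨2 * k, hm0⟩).1 ≠ 2 * k := fun h4 => qq_ne n σ ⟨2 * k, hm0⟩ (Fin.ext h4)
    have hb := step_black n (2 * k) hm0 σ
    omega
  rw [e13] at d3
  have s1 : (Finset.univ.filter fun σ : Equiv.Perm (Fin (2 * n)) =>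
      wbCount (2 * n) (2 * k) σ < 2 * ne + 1).card =
      (Finset.univ.filter fun σ : Equiv.Perm (Fin (2 * n)) =>
      wbCount (2 * n) (2 * k + 1) σ < 2 * ne + 1).card +
      (Finset.univ.filter fun σ : Equiv.Perm (Fin (2 * n)) =>
      wbCount (2 * n) (2 * k) σ = 2 * ne ∧ ¬ (qq n σ ⟨2 * k, hm0⟩).1 < 2 * k).card := by
    rw [← Finset.card_union_of_disjoint]
    · congr 1
      ext σ
      simp only [Finset.mem_filter, Finset.mem_univ, true_and, Finset.mem_union]
      have hb := step_black n (2 * k) hm0 σ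
      have hw := step_white n (2 * k) hm0 σ
      have p0 := wb_parity n (2 * k) hm0.le σ
      omega
    · rw [Finset.disjoint_filter]
      intro σ _
      have hb := step_black n (2 * k) hm0 σ
      omega
  have s2 : (Finset.univ.filter fun σ : Equiv.Perm (Fin (2 * n)) =>
      wbCount (2 * n) (2 * k + 2) σ < 2 * ne + 1).card =
      (Finset.univ.filter fun σ : Equiv.Perm (Fin (2 * n)) =>
      wbCount (2 * n) (2 * k + 1) σ < 2 * ne + 1).card +
      (Finset.univ.filter fun σ : Equiv.Perm (Fin (2 * n)) =>
      wbCount (2 * n) (2 * k + 1) σ = 2 * ne + 1 ∧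
        (qq n σ ⟨2 * k + 1, hm1⟩).1 < 2 * k + 1).card := by
    rw [← Finset.card_union_of_disjoint]
    · congr 1
      ext σ
      simp only [Finset.mem_filter, Finset.mem_univ, true_and, Finset.mem_union]
      have hb : _ → wbCount (2 * n) (2 * k + 2) σ = _ := step_black n (2 * k + 1) hm1 σ
      have hw : _ → _ = wbCount (2 * n) (2 * k + 2) σ + 1 := step_white n (2 * k + 1) hm1 σ
      have p0 := wb_parity n (2 * k + 1) hm1.le σ
      omega
    · rw [Finset.disjoint_filter]
      intro σ _
      omega
  have hF : (0 : ℝ) < (Fintype.card (Equiv.Perm (Fin (2 * n))) : ℝ) := by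
    exact_mod_cast Fintype.card_pos
  simp only [epsWB, PexactWB] at hx1 hx2 ⊢
  generalize (Finset.univ.filter fun σ : Equiv.Perm (Fin (2 * n)) =>
      wbCount (2 * n) (2 * k) σ = 2 * ne ∧ ¬ (qq n σ ⟨2 * k, hm0⟩).1 < 2 * k).card = T1 at *
  generalize (Finset.univ.filter fun σ : Equiv.Perm (Fin (2 * n)) =>
      wbCount (2 * n) (2 * k) σ = 2 * ne ∧ (qq n σ ⟨2 * k, hm0⟩).1 < 2 * k).card = T1' at *
  generalize (Finset.univ.filter fun σ : Equiv.Perm (Fin (2 * n)) =>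
      wbCount (2 * n) (2 * k + 1) σ = 2 * ne + 1 ∧
        (qq n σ ⟨2 * k + 1, hm1⟩).1 < 2 * k + 1).card = T2 at *
  generalize (Finset.univ.filter fun σ : Equiv.Perm (Fin (2 * n)) =>
      wbCount (2 * n) (2 * k) σ = 2 * ne).card = A at *
  generalize (Finset.univ.filter fun σ : Equiv.Perm (Fin (2 * n)) =>
      wbCount (2 * n) (2 * k + 1) σ = 2 * ne + 1).card = A' at *
  generalize (Finset.univ.filter fun σ : Equiv.Perm (Fin (2 * n)) =>
      wbCount (2 * n) (2 * k) σ < 2 * ne + 1).card = E0 at *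
  generalize (Finset.univ.filter fun σ : Equiv.Perm (Fin (2 * n)) =>
      wbCount (2 * n) (2 * k + 1) σ < 2 * ne + 1).card = E1 at *
  generalize (Finset.univ.filter fun σ : Equiv.Perm (Fin (2 * n)) =>
      wbCount (2 * n) (2 * k + 2) σ < 2 * ne + 1).card = E2 at *
  generalize (Fintype.card (Equiv.Perm (Fin (2 * n))) : ℝ) = F at *
  have hn : (2 * k + 1 : ℝ) ≤ n := by
    have : 2 * k + 1 ≤ n := by omega
    exact_mod_cast this
  have hk : (0 : ℝ) ≤ k := Nat.cast_nonneg k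
  have r1 := congrArg (Nat.cast : ℕ → ℝ) d1
  have r2 := congrArg (Nat.cast : ℕ → ℝ) d2
  have r3 := congrArg (Nat.cast : ℕ → ℝ) d3
  have r4 := congrArg (Nat.cast : ℕ → ℝ) eA
  have r5 := congrArg (Nat.cast : ℕ → ℝ) s1
  have r6 := congrArg (Nat.cast : ℕ → ℝ) s2
  rw [Nat.cast_mul, Nat.cast_sub hm0.le] at r1
  rw [Nat.cast_mul, Nat.cast_sub hm1.le] at r2
  push_cast at r1 r2 r3 r4 r5 r6
  have hD0 : (0 : ℝ) < 2 * n - 2 * k := by linarith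
  have hD1 : (0 : ℝ) < 2 * n - (2 * k + 1) := by linarith
  have hx1' : x1 = T1 / F := by
    rw [hx1, div_mul_div_comm, div_eq_div_iff (by positivity) (by positivity)]
    rw [← r4] at r1 ⊢
    linear_combination F * r1
  have hx2' : x2 = T2 / F := by
    rw [hx2, div_mul_div_comm, div_eq_div_iff (by positivity) (by positivity)]
    linear_combination (-F) * r2
  refine ⟨?_, ?_, ?_⟩
  · rw [hx1', r5]; ring
  · rw [hx1', r5, r6, hx2']; ring
  · intro hpos
    refine ⟨?_, ?_⟩
    · rw [div_eq_iff hpos.ne', hx1', hx2']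
      field_simp
      linear_combination r3 - r2
    · rw [le_sub_iff_add_le, le_div_iff₀ (by positivity)]
      linarith
end

section
/- Let N be an even positive integer, k_u a nonnegative integer with k_u ≤ N/2, n̄ a nonnegative integer, and p_u ∈ [0,1]. Set γ'_iid = Σ_{k=0}^{k_u} C(N,k) p_u^k (1−p_u)^{N−k}, and assume γ'_iid > 0. Then ε(n̄ | [k_u, N]) ≤ ε(n̄ + 1 | [p_u, N]_iid) / γ'_iid, where ε counts wb-pairs and ε(n̄ + 1 | [p_u, N]_iid) = Σ_{k=0}^{n̄} C(N/2, k) P^k (1−P)^{N/2−k} with P = 2 p_u (1 − p_u). (Paper's Theorem 2.) -/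
/-- ε(n̄ | [p,N]_iid) for wb-pairs: the binomial mixture
Σ_m C(N,m) p^m (1-p)^(N-m) ε(n̄ | [m,N]). -/
noncomputable def epsWBiid (N nbar : ℕ) (p : ℝ) : ℝ :=
  ∑ m ∈ Finset.range (N + 1),
    (N.choose m : ℝ) * p ^ m * (1 - p) ^ (N - m) * epsWB N m nbar


/-- number of white balls of a coloring -/
def wtC {N : ℕ} (c : Fin N → Bool) : ℕ := (Finset.univ.filter fun j => c j = true).card

def lo {N : ℕ} (i : Fin (N / 2)) : Fin N := ⟨2 * i.1, by have := i.isLt; omega⟩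
def hi {N : ℕ} (i : Fin (N / 2)) : Fin N := ⟨2 * i.1 + 1, by have := i.isLt; omega⟩

def wbC {N : ℕ} (c : Fin N → Bool) : ℕ :=
  (Finset.univ.filter fun i : Fin (N / 2) => c (lo i) ≠ c (hi i)).card

def colS {N : ℕ} (k : ℕ) (σ : Equiv.Perm (Fin N)) : Fin N → Bool := fun j => decide ((σ j).1 < k)

def cntA (N k w : ℕ) : ℕ :=
  (Finset.univ.filter fun c : Fin N → Bool => wtC c = k ∧ wbC c = w).card

lemma wbCount_eq_s13 (N k : ℕ) (σ : Equiv.Perm (Fin N)) : wbCount N k σ = wbC (colS k σ) := by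
  unfold wbCount wbC
  congr 1
  ext i
  simp only [Finset.mem_filter, Finset.mem_univ, true_and]
  simp only [colS, lo, hi]
  by_cases h1 : (σ ⟨2 * i.1, by have := i.isLt; omega⟩).1 < k <;>
  by_cases h2 : (σ ⟨2 * i.1 + 1, by have := i.isLt; omega⟩).1 < k <;> simp [h1, h2]

def pairEquiv {N : ℕ} (h : 2 * (N / 2) = N) : Fin (N / 2) × Bool ≃ Fin N where
  toFun x := if x.2 then hi x.1 else lo x.1
  invFun j := (⟨j.1 / 2, by have := j.isLt; omega⟩, decide (j.1 % 2 = 1))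
  left_inv := by
    rintro ⟨i, b⟩
    cases b <;> simp [lo, hi, Fin.ext_iff] <;> omega
  right_inv := by
    intro j
    by_cases hj : j.1 % 2 = 1 <;> simp [lo, hi, Fin.ext_iff, hj] <;> omega

lemma prod_pair_s13 {R : Type*} [CommMonoid R] {N : ℕ} (h : 2 * (N / 2) = N) (g : Fin N → R) :
    ∏ j, g j = ∏ i : Fin (N / 2), (g (lo i) * g (hi i)) := by
  rw [← Equiv.prod_comp (pairEquiv h), Fintype.prod_prod_type]
  refine Finset.prod_congr rfl fun i _ => ?_
  simp [pairEquiv, mul_comm]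

def fnEquiv {N : ℕ} (h : 2 * (N / 2) = N) : (Fin N → Bool) ≃ (Fin (N / 2) → Bool × Bool) where
  toFun c i := (c (lo i), c (hi i))
  invFun f j := if j.1 % 2 = 1 then (f ⟨j.1 / 2, by have := j.isLt; omega⟩).2
    else (f ⟨j.1 / 2, by have := j.isLt; omega⟩).1
  left_inv := by
    intro c
    funext j
    by_cases hj : j.1 % 2 = 1
    · simp only [hj, if_true]
      congr 1
      simp [hi, Fin.ext_iff]; omega
    · simp only [hj, if_false]
      congr 1
      simp [lo, Fin.ext_iff]; omega
  right_inv := by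
    intro f
    funext i
    have e1 : (2 * i.1) / 2 = i.1 := by omega
    have e2 : (2 * i.1 + 1) / 2 = i.1 := by omega
    have e3 : (2 * i.1 + 1) % 2 = 1 := by omega
    ext <;> simp [lo, hi, e1, e2, e3]

lemma prod_wt {R : Type*} [CommSemiring R] {N : ℕ} (p q : R) (c : Fin N → Bool) :
    ∏ j, (if c j = true then p else q) = p ^ wtC c * q ^ (N - wtC c) := by
  rw [Finset.prod_ite, Finset.prod_const, Finset.prod_const]
  congr 2
  have := Finset.card_filter_add_card_filter_not (s := (Finset.univ : Finset (Fin N)))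
    (fun j => c j = true)
  simp only [Finset.card_univ, Fintype.card_fin] at this
  unfold wtC
  omega

open Polynomial in
lemma gf {R : Type*} [CommSemiring R] {N : ℕ} (h : 2 * (N / 2) = N) (p q : R) (w : ℕ) :
    ∑ c : Fin N → Bool with wbC c = w, p ^ wtC c * q ^ (N - wtC c) =
      ((N / 2).choose w : R) * (2 * p * q) ^ w * (p ^ 2 + q ^ 2) ^ (N / 2 - w) := by
  let u : Bool → R := fun b => if b = true then p else q
  let G : Bool × Bool → R[X] := fun b => C (u b.1 * u b.2) * (if b.1 ≠ b.2 then X else 1)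
  have h1 := Fintype.sum_pow G (N / 2)
  rw [← Equiv.sum_comp (fnEquiv h)] at h1
  have h2 : ∀ c : Fin N → Bool, ∏ i, G (fnEquiv h c i) =
      C (p ^ wtC c * q ^ (N - wtC c)) * X ^ wbC c := by
    intro c
    simp only [G, Finset.prod_mul_distrib, fnEquiv, Equiv.coe_fn_mk]
    rw [← map_prod, ← prod_wt, prod_pair_s13 h, Finset.prod_ite, Finset.prod_const, Finset.prod_const]
    simp only [one_pow, mul_one]
    rfl
  simp only [h2] at h1
  have h3 : ∑ a, G a = C (2 * p * q) * X + C (p ^ 2 + q ^ 2) := by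
    simp only [Fintype.sum_prod_type, Fintype.sum_bool, G, u]
    simp only [two_mul, add_mul, sq, map_add, map_mul]
    simp
    ring
  rw [h3] at h1
  have h4 := congrArg (fun P => coeff P w) h1
  simp only [finsetSum_coeff, coeff_C_mul, coeff_X_pow] at h4
  rw [Finset.sum_filter]
  have h5 : (∑ c : Fin N → Bool, if wbC c = w then p ^ wtC c * q ^ (N - wtC c) else 0) =
      ∑ x : Fin N → Bool, p ^ wtC x * q ^ (N - wtC x) * (if w = wbC x then 1 else 0) := by
    refine Finset.sum_congr rfl fun c _ => ?_
    by_cases hc : wbC c = w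
    · simp [hc]
    · simp [hc, Ne.symm hc]
  rw [h5, ← h4, add_pow]
  simp only [finsetSum_coeff, mul_pow, ← C_pow, ← C_eq_natCast]
  have : ∀ x : ℕ, (C ((2 * p * q) ^ x) * X ^ x * C ((p ^ 2 + q ^ 2) ^ (N / 2 - x)) *
      C (((N / 2).choose x : ℕ) : R)) = C (((N / 2).choose x : R) * (2 * p * q) ^ x *
        (p ^ 2 + q ^ 2) ^ (N / 2 - x)) * X ^ x := by
    intro x; simp only [C_mul]; ring
  simp only [← mul_pow] at *
  simp only [this, coeff_C_mul, coeff_X_pow]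
  simp only [mul_ite, mul_one, mul_zero, Finset.sum_ite_eq, Finset.mem_range]
  split_ifs with hw
  · rfl
  · rw [Nat.choose_eq_zero_of_lt (by omega)]; simp

open Polynomial in
lemma card_wt (N k : ℕ) :
    (Finset.univ.filter fun c : Fin N → Bool => wtC c = k).card = N.choose k := by
  have h1 := Fintype.sum_pow (fun b : Bool => if b = true then (X : ℕ[X]) else 1) N
  simp only [prod_wt] at h1
  have h4 := congrArg (fun P => coeff P k) h1
  simp only [finsetSum_coeff, Fintype.sum_bool, one_pow, mul_one, coeff_X_pow] at h4
  simp [coeff_X_add_one_pow] at h4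
  rw [h4]
  congr 1
  ext c; simp [eq_comm]

open Polynomial in
lemma cntA_eq {N : ℕ} (h : 2 * (N / 2) = N) (k w : ℕ) :
    cntA N k w = if w ≤ k ∧ 2 ∣ (k - w) then
      (N / 2).choose w * 2 ^ w * (N / 2 - w).choose ((k - w) / 2) else 0 := by
  have h1 := gf h (X : ℕ[X]) 1 w
  have h4 := congrArg (fun P => coeff P k) h1
  simp only [finsetSum_coeff, one_pow, mul_one, coeff_X_pow] at h4
  have e : (X ^ 2 + 1 : ℕ[X]) ^ (N / 2 - w) = expand ℕ 2 ((X + 1) ^ (N / 2 - w)) := by simp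
  have e2 : (((N / 2).choose w : ℕ[X]) * (2 * X) ^ w * (X ^ 2 + 1) ^ (N / 2 - w)) =
     C ((N / 2).choose w * 2 ^ w) * (X ^ w * expand ℕ 2 ((X + 1) ^ (N / 2 - w))) := by
    rw [← e]; simp [mul_pow]; ring
  rw [e2, coeff_C_mul, coeff_X_pow_mul', coeff_expand (by norm_num)] at h4
  have e3 : cntA N k w = ∑ x : Fin N → Bool with wbC x = w, if k = wtC x then 1 else 0 := by
    rw [← Finset.sum_filter, Finset.sum_const, Finset.filter_filter, smul_eq_mul, mul_one]
    unfold cntA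
    congr 1
    ext c; simp [eq_comm, and_comm]
  rw [e3, h4]
  by_cases h5 : w ≤ k <;> by_cases h6 : 2 ∣ (k - w) <;> simp [h5, h6, coeff_X_add_one_pow]

lemma wt_colS {N k : ℕ} (hk : k ≤ N) (σ : Equiv.Perm (Fin N)) : wtC (colS k σ) = k := by
  unfold wtC colS
  simp only [decide_eq_true_eq]
  have : (Finset.univ.filter fun j : Fin N => (σ j).1 < k).card =
      (Finset.univ.filter fun j : Fin N => j.1 < k).card := by
    refine Finset.card_bij (fun j _ => σ j) ?_ ?_ ?_
    · simp
    · simp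
    · intro b hb; exact ⟨σ.symm b, by simpa using hb, by simp⟩
  rw [this, Fin.card_filter_val_lt]
  omega

lemma trans_col {N : ℕ} (c c' : Fin N → Bool) (h : wtC c = wtC c') :
    ∃ τ : Equiv.Perm (Fin N), c' = c ∘ τ := by
  have e : Fintype.card {x // c' x = true} = Fintype.card {x // c x = true} := by
    rw [Fintype.card_subtype, Fintype.card_subtype]; exact h.symm
  let e' := Fintype.equivOfCardEq e
  refine ⟨e'.extendSubtype, ?_⟩
  funext x
  by_cases hx : c' x = true
  · rw [hx]; exact (e'.extendSubtype_mem x hx).symm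
  · have := e'.extendSubtype_not_mem x hx
    simp only [Function.comp]
    rw [Bool.not_eq_true] at hx this
    rw [hx, this]

lemma wt_comp {N : ℕ} (c : Fin N → Bool) (σ : Equiv.Perm (Fin N)) : wtC (c ∘ σ) = wtC c := by
  unfold wtC
  refine Finset.card_bij (fun j _ => σ j) ?_ ?_ ?_
  · simp
  · simp
  · intro b hb; exact ⟨σ.symm b, by simpa using hb, by simp⟩

lemma dbl_s13 {N k : ℕ} (hk : k ≤ N) (F : (Fin N → Bool) → ℕ) :
    N.choose k * ∑ σ : Equiv.Perm (Fin N), F (colS k σ) =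
      Fintype.card (Equiv.Perm (Fin N)) * ∑ c : Fin N → Bool with wtC c = k, F c := by
  have h1 : ∀ c ∈ (Finset.univ.filter fun c : Fin N → Bool => wtC c = k),
      ∑ σ : Equiv.Perm (Fin N), F (c ∘ σ) = ∑ σ : Equiv.Perm (Fin N), F (colS k σ) := by
    intro c hc
    simp only [Finset.mem_filter, Finset.mem_univ, true_and] at hc
    obtain ⟨τ, hτ⟩ := trans_col (colS k (1 : Equiv.Perm (Fin N))) c (by rw [wt_colS hk, hc])
    rw [← Equiv.sum_comp (Equiv.mulLeft τ) (fun σ => F (colS k σ))]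
    refine Finset.sum_congr rfl fun σ _ => ?_
    rw [hτ]
    rfl
  have h2 : ∀ σ ∈ (Finset.univ : Finset (Equiv.Perm (Fin N))),
      ∑ c : Fin N → Bool with wtC c = k, F (c ∘ σ) = ∑ c : Fin N → Bool with wtC c = k, F c := by
    intro σ _
    refine Finset.sum_bij' (fun c _ => c ∘ σ) (fun c _ => c ∘ σ.symm) ?_ ?_ ?_ ?_ ?_
    · intro c hc; simpa [wt_comp] using hc
    · intro c hc; simpa [wt_comp] using hc
    · intro c _; funext x; simp
    · intro c _; funext x; simp
    · intro c _; rfl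
  rw [← card_wt, ← smul_eq_mul, ← Finset.sum_const, ← Finset.sum_congr rfl h1, Finset.sum_comm,
    Finset.sum_congr rfl h2, Finset.sum_const, smul_eq_mul, Finset.card_univ]

lemma sum_cntA (N k n : ℕ) : ∑ w ∈ Finset.range n, cntA N k w =
    (Finset.univ.filter fun c : Fin N → Bool => wtC c = k ∧ wbC c < n).card := by
  rw [Finset.card_eq_sum_card_fiberwise (f := wbC) (t := Finset.range n)]
  · refine Finset.sum_congr rfl fun w hw => ?_
    unfold cntA
    congr 1
    ext c
    simp at hw ⊢
    grind
  · intro c hc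
    simp at hc ⊢
    exact hc.2

lemma eps_choose {N k : ℕ} (hk : k ≤ N) (n : ℕ) :
    (N.choose k : ℝ) * epsWB N k n = ((∑ w ∈ Finset.range n, cntA N k w : ℕ) : ℝ) := by
  have h := dbl_s13 hk (fun c => if wbC c < n then 1 else 0)
  have hpos : (0 : ℝ) < Fintype.card (Equiv.Perm (Fin N)) := by exact_mod_cast Fintype.card_pos
  simp only [← Finset.card_filter, Finset.filter_filter] at h
  unfold epsWB
  rw [sum_cntA, ← mul_div_assoc, div_eq_iff hpos.ne']
  simp only [wbCount_eq_s13]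
  rw [mul_comm ((_ : ℕ) : ℝ) (Fintype.card _ : ℝ)]
  exact_mod_cast h

lemma wbC_le {N : ℕ} (c : Fin N → Bool) : wbC c ≤ N / 2 := by
  unfold wbC
  exact (Finset.card_filter_le _ _).trans (by simp)

lemma sum_cntA_all (N k : ℕ) : ∑ w ∈ Finset.range (N / 2 + 1), cntA N k w = N.choose k := by
  rw [sum_cntA, ← card_wt]
  congr 1
  ext c
  have := wbC_le c
  simp; omega

lemma cross {N : ℕ} (h : 2 * (N / 2) = N) {k w v : ℕ} (hk : k + 2 ≤ N / 2) (hw : w ≤ v) :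
    cntA N (k + 2) w * cntA N k v ≤ cntA N k w * cntA N (k + 2) v := by
  rw [cntA_eq h k v]
  split_ifs with hv
  swap
  · simp
  rw [cntA_eq h (k + 2) w]
  split_ifs with hw2
  swap
  · simp
  obtain ⟨b, hb⟩ := hv.2
  obtain ⟨a, ha⟩ : 2 ∣ k - w := by omega
  rw [cntA_eq h k w, cntA_eq h (k + 2) v, if_pos (by omega), if_pos (by omega)]
  have e1 : (k + 2 - w) / 2 = a + 1 := by omega
  have e2 : (k + 2 - v) / 2 = b + 1 := by omega
  have e3 : (k - w) / 2 = a := by omega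
  have e4 : (k - v) / 2 = b := by omega
  rw [e1, e2, e3, e4]
  have key : (N / 2 - w).choose (a + 1) * (N / 2 - v).choose b ≤
      (N / 2 - w).choose a * (N / 2 - v).choose (b + 1) := by
    have r1 := Nat.choose_succ_right_eq (N / 2 - w) a
    have r2 := Nat.choose_succ_right_eq (N / 2 - v) b
    obtain ⟨D, hD⟩ : ∃ D, N / 2 - k = D + 1 := ⟨N / 2 - k - 1, by omega⟩
    rw [show N / 2 - w - a = D + 1 + a by omega] at r1
    rw [show N / 2 - v - b = D + 1 + b by omega] at r2
    have hab : b ≤ a := by omega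
    refine Nat.le_of_mul_le_mul_right (c := (a + 1) * (b + 1)) ?_ (by positivity)
    calc _ = ((N / 2 - w).choose (a + 1) * (a + 1)) * (N / 2 - v).choose b * (b + 1) := by ring
      _ = (N / 2 - w).choose a * (N / 2 - v).choose b * ((D + 1 + a) * (b + 1)) := by
        rw [r1]; ring
      _ ≤ (N / 2 - w).choose a * (N / 2 - v).choose b * ((D + 1 + b) * (a + 1)) := by
        apply Nat.mul_le_mul_left
        nlinarith [Nat.mul_le_mul_left D hab]
      _ = (N / 2 - w).choose a * ((N / 2 - v).choose (b + 1) * (b + 1)) * (a + 1) := by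
        rw [r2]; ring
      _ = _ := by ring
  calc _ = ((N / 2).choose w * 2 ^ w * ((N / 2).choose v * 2 ^ v)) *
        ((N / 2 - w).choose (a + 1) * (N / 2 - v).choose b) := by ring
    _ ≤ ((N / 2).choose w * 2 ^ w * ((N / 2).choose v * 2 ^ v)) *
        ((N / 2 - w).choose a * (N / 2 - v).choose (b + 1)) := Nat.mul_le_mul_left _ key
    _ = _ := by ring

lemma eps_nonneg (N k n : ℕ) : 0 ≤ epsWB N k n := by unfold epsWB; positivity

lemma eps_mono (N k : ℕ) {n n' : ℕ} (h : n ≤ n') : epsWB N k n ≤ epsWB N k n' := by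
  unfold epsWB
  gcongr

lemma eps_two {N : ℕ} (h : 2 * (N / 2) = N) {k : ℕ} (hk : k + 2 ≤ N / 2) (n : ℕ) :
    epsWB N (k + 2) n ≤ epsWB N k n := by
  have E1 := eps_choose (show k ≤ N by omega) n
  have E2 := eps_choose (show k + 2 ≤ N by omega) n
  set T1 := N.choose k with hT1
  set T2 := N.choose (k + 2) with hT2
  have p1 : (0 : ℝ) < T1 := by exact_mod_cast Nat.choose_pos (by omega)
  have p2 : (0 : ℝ) < T2 := by exact_mod_cast Nat.choose_pos (by omega)
  rcases Nat.lt_or_ge (N / 2) n with hn | hn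
  · have one : ∀ j, epsWB N j n = 1 := by
      intro j
      unfold epsWB
      rw [Finset.filter_true_of_mem]
      · rw [Finset.card_univ, div_self]
        exact_mod_cast Fintype.card_ne_zero
      · intro σ _; rw [wbCount_eq_s13]; exact lt_of_le_of_lt (wbC_le _) hn
    rw [one, one]
  have S1 := Finset.sum_range_add_sum_Ico (cntA N k) (show n ≤ N / 2 + 1 by omega)
  have S2 := Finset.sum_range_add_sum_Ico (cntA N (k + 2)) (show n ≤ N / 2 + 1 by omega)
  rw [sum_cntA_all] at S1 S2
  have C : (∑ w ∈ Finset.range n, cntA N (k + 2) w) * ∑ v ∈ Finset.Ico n (N / 2 + 1), cntA N k v ≤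
      (∑ w ∈ Finset.range n, cntA N k w) * ∑ v ∈ Finset.Ico n (N / 2 + 1), cntA N (k + 2) v := by
    rw [Finset.sum_mul_sum, Finset.sum_mul_sum]
    refine Finset.sum_le_sum fun w hw => Finset.sum_le_sum fun v hv => cross h hk ?_
    simp at hw hv; omega
  have C2 : (∑ w ∈ Finset.range n, cntA N (k + 2) w) * T1 ≤
      (∑ w ∈ Finset.range n, cntA N k w) * T2 := by
    rw [hT1, hT2, ← S1, ← S2]; nlinarith
  have C3 : ((∑ w ∈ Finset.range n, cntA N (k + 2) w : ℕ) : ℝ) * T1 ≤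
      ((∑ w ∈ Finset.range n, cntA N k w : ℕ) : ℝ) * T2 := by exact_mod_cast C2
  rw [← E1, ← E2] at C3
  refine le_of_mul_le_mul_left (a := (T1 : ℝ) * T2) ?_ (by positivity)
  linarith

lemma eps_step (N k n : ℕ) : epsWB N (k + 1) n ≤ epsWB N k (n + 1) := by
  unfold epsWB
  refine div_le_div_of_nonneg_right (Nat.cast_le.2 (Finset.card_le_card ?_)) (by positivity)
  intro σ h'
  simp only [Finset.mem_filter, Finset.mem_univ, true_and] at h' ⊢
  have : wbCount N k σ ≤ wbCount N (k + 1) σ + 1 := by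
    rw [wbCount_eq_s13, wbCount_eq_s13]
    by_cases hs : ∃ i : Fin (N / 2), (σ (lo i)).1 = k ∨ (σ (hi i)).1 = k
    · obtain ⟨i, hi'⟩ := hs
      unfold wbC
      refine le_trans (Finset.card_le_card (t := insert i _) ?_) (Finset.card_insert_le i _)
      intro j hj
      simp only [Finset.mem_insert, Finset.mem_filter, Finset.mem_univ, true_and] at hj ⊢
      by_cases hji : j = i
      · exact Or.inl hji
      right
      have hne : j.1 ≠ i.1 := fun h => hji (Fin.ext h)
      have inj : ∀ a b : Fin N, (σ a).1 = k → (σ b).1 = k → a.1 = b.1 := fun a b ha hb => by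
        rw [σ.injective (Fin.ext (ha.trans hb.symm))]
      have n1 : (σ (lo j)).1 ≠ k := by
        intro hh
        rcases hi' with h1 | h1 <;> have := inj _ _ hh h1 <;> simp [lo, hi] at this <;> omega
      have n2 : (σ (hi j)).1 ≠ k := by
        intro hh
        rcases hi' with h1 | h1 <;> have := inj _ _ hh h1 <;> simp [lo, hi] at this <;> omega
      have t1 : (σ (lo j)).1 < k + 1 ↔ (σ (lo j)).1 < k := by omega
      have t2 : (σ (hi j)).1 < k + 1 ↔ (σ (hi j)).1 < k := by omega
      simpa only [colS, t1, t2] using hj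
    · push Not at hs
      refine le_trans (le_of_eq ?_) (Nat.le_succ _)
      unfold wbC
      congr 1
      ext j
      have t1 : (σ (lo j)).1 < k + 1 ↔ (σ (lo j)).1 < k := by have := (hs j).1; omega
      have t2 : (σ (hi j)).1 < k + 1 ↔ (σ (hi j)).1 < k := by have := (hs j).2; omega
      rw [Finset.mem_filter, Finset.mem_filter]
      simp only [colS, t1, t2]
  omega

lemma eps_chain {N : ℕ} (h : 2 * (N / 2) = N) (m d n : ℕ) (hk : m + 2 * d ≤ N / 2) :
    epsWB N (m + 2 * d) n ≤ epsWB N m n := by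
  induction d with
  | zero => simp
  | succ d ih => exact (eps_two h (k := m + 2 * d) (by omega) n).trans (ih (by omega))

lemma eps_main {N : ℕ} (h : 2 * (N / 2) = N) {m k : ℕ} (hmk : m ≤ k) (hk : k ≤ N / 2) (n : ℕ) :
    epsWB N k n ≤ epsWB N m (n + 1) := by
  obtain ⟨d, hd | hd⟩ : ∃ d, k = m + 2 * d ∨ k = m + 2 * d + 1 := ⟨(k - m) / 2, by omega⟩
  · subst hd
    exact (eps_chain h m d n hk).trans (eps_mono N m (by omega))
  · subst hd
    exact (eps_step N (m + 2 * d) n).trans (eps_chain h m d (n + 1) (by omega))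

lemma iid_eq {N : ℕ} (h : 2 * (N / 2) = N) (n : ℕ) (p : ℝ) :
    epsWBiid N n p = ∑ k ∈ Finset.range n,
      ((N / 2).choose k : ℝ) * (2 * p * (1 - p)) ^ k *
        (1 - 2 * p * (1 - p)) ^ (N / 2 - k) := by
  have e : 1 - 2 * p * (1 - p) = p ^ 2 + (1 - p) ^ 2 := by ring
  rw [e]
  simp only [← gf h]
  unfold epsWBiid
  have h1 : ∀ m ∈ Finset.range (N + 1), (N.choose m : ℝ) * p ^ m * (1 - p) ^ (N - m) * epsWB N m n =
      ∑ w ∈ Finset.range n, (cntA N m w : ℝ) * (p ^ m * (1 - p) ^ (N - m)) := by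
    intro m hm
    simp only [Finset.mem_range] at hm
    rw [← Finset.sum_mul, ← Nat.cast_sum, ← eps_choose (by omega)]
    ring
  rw [Finset.sum_congr rfl h1, Finset.sum_comm]
  refine Finset.sum_congr rfl fun w _ => ?_
  rw [← Finset.sum_fiberwise_of_maps_to (g := wtC) (t := Finset.range (N + 1))]
  · refine Finset.sum_congr rfl fun m _ => ?_
    rw [Finset.filter_filter, Finset.sum_congr rfl (g := fun _ => p ^ m * (1 - p) ^ (N - m)),
      Finset.sum_const, nsmul_eq_mul]
    · unfold cntA
      simp only [and_comm]
    · intro c hc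
      simp at hc
      rw [hc.2]
  · intro c _
    have : wtC c ≤ N := (Finset.card_filter_le _ _).trans (by simp)
    simp; omega

/-- Paper's Theorem 2: ε(n̄ | [k_u,N]) ≤ ε(n̄+1 | [p_u,N]_iid) / γ'_iid for wb-pairs,
where γ'_iid = Σ_{k=0}^{k_u} C(N,k) p_u^k (1-p_u)^(N-k) > 0, and
ε(n̄+1 | [p_u,N]_iid) = Σ_{k=0}^{n̄} C(N/2,k) P^k (1-P)^(N/2-k) with P = 2p_u(1-p_u). -/
theorem theorem2_wb (N ku nbar : ℕ) (hN : Even N) (hNpos : 0 < N) (hku : ku ≤ N / 2)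
    (pu : ℝ) (hp0 : 0 ≤ pu) (hp1 : pu ≤ 1) (γiid' : ℝ)
    (hγ : γiid' = ∑ k ∈ Finset.range (ku + 1),
      (N.choose k : ℝ) * pu ^ k * (1 - pu) ^ (N - k))
    (hγpos : 0 < γiid') :
    epsWB N ku nbar ≤ epsWBiid N (nbar + 1) pu / γiid' ∧
    epsWBiid N (nbar + 1) pu = ∑ k ∈ Finset.range (nbar + 1),
      ((N / 2).choose k : ℝ) * (2 * pu * (1 - pu)) ^ k *
        (1 - 2 * pu * (1 - pu)) ^ (N / 2 - k) := by
  have h : 2 * (N / 2) = N := by obtain ⟨r, hr⟩ := hN; omega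
  refine ⟨?_, iid_eq h _ _⟩
  rw [le_div_iff₀ hγpos, hγ, Finset.mul_sum]
  have hq : 0 ≤ 1 - pu := by linarith
  unfold epsWBiid
  calc _ ≤ ∑ m ∈ Finset.range (ku + 1),
        (N.choose m : ℝ) * pu ^ m * (1 - pu) ^ (N - m) * epsWB N m (nbar + 1) := by
        refine Finset.sum_le_sum fun m hm => ?_
        simp only [Finset.mem_range] at hm
        rw [mul_comm]
        exact mul_le_mul_of_nonneg_left (eps_main h (by omega) hku nbar) (by positivity)
    _ ≤ _ := by
        refine Finset.sum_le_sum_of_subset_of_nonneg ?_ ?_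
        · intro m hm
          simp only [Finset.mem_range] at hm ⊢
          omega
        · intro m _ _
          have := eps_nonneg N m (nbar + 1)
          positivity
end
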